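/- arXiv:2401.08531 — 6 statements merged into one kernel-verified Lean document; each statement's English description precedes it below -/
import Mathlib

section
/- For every integer n ≥ 1, the function u_n : Q → ℝ defined by u_n(x,t) = (x / (2√π)) · ∂^{n−1}/∂t^{n−1} ( t^{−3/2} exp(−x²/(4t)) ) (the (n−1)-st partial derivative in t) is smooth on Q, satisfies the heat equation ∂u_n/∂t = ∂²u_n/∂x² at every point of Q, and satisfies lim_{x→0⁺} u_n(x,t) = 0 for every t > 0 and lim_{t→0⁺} u_n(x,t) = 0 for every x > 0. -/
open MeasureTheory Filter Set Topology

/-- `u_n(x,t) = (x/(2√π)) · ∂^{n−1}/∂t^{n−1} ( t^{−3/2} exp(−x²/(4t)) )`. -/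
noncomputable def heatUn (n : ℕ) (x t : ℝ) : ℝ :=
  x / (2 * Real.sqrt Real.pi) *
    iteratedDeriv (n - 1) (fun s : ℝ => s ^ (-(3:ℝ)/2) * Real.exp (-(x^2) / (4*s))) t

open Polynomial in
/-- The polynomials `Q_m` with `∂_s^m (s^{-3/2} e^{-z/(4s)}) = s^{-3/2-m} Q_m(z/s) e^{-z/(4s)}`. -/
noncomputable def heatQ : ℕ → Polynomial ℝ
  | 0 => 1
  | m + 1 => (C (1/4 : ℝ) * X - C (3/2 + (m:ℝ))) * heatQ m - X * derivative (heatQ m)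

open Polynomial in
lemma heatQ_ode (m : ℕ) :
    4 * X * derivative (derivative (heatQ m)) + (6 - X) * derivative (heatQ m)
      + C (m:ℝ) * heatQ m = 0 := by
  induction m with
  | zero => simp [heatQ]
  | succ m ih =>
    have h1 := congrArg (derivative (R := ℝ)) ih
    have e1 : C (3/2 + (m:ℝ)) = C (1/4:ℝ) * 6 + C (m:ℝ) := by
      have : (6 : Polynomial ℝ) = C 6 := rfl
      rw [this, ← C_mul, ← C_add]; norm_num
    have e2 : C (1/4:ℝ) * 4 = 1 := by
      have : (4 : Polynomial ℝ) = C 4 := rfl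
      rw [this, ← C_mul]; norm_num
    simp only [heatQ, e1]
    have d6 : derivative (6 : Polynomial ℝ) = 0 := derivative_ofNat 6
    have d4 : derivative (4 : Polynomial ℝ) = 0 := derivative_ofNat 4
    simp only [derivative_add, derivative_sub, derivative_mul, derivative_C, derivative_X,
      d6, d4, derivative_zero, derivative_one, Nat.cast_add, Nat.cast_one, C_add, C_1] at h1 ih ⊢
    generalize derivative (derivative (derivative (heatQ m))) = q3 at *
    generalize derivative (derivative (heatQ m)) = q2 at *
    generalize derivative (heatQ m) = q1 at *
    generalize heatQ m = q0 at *
    generalize (C (1/4:ℝ)) = k at *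
    generalize (C (m:ℝ)) = c at *
    linear_combination (-X) * h1 + (k * X - 10 * k - c) * ih + (X * q1 + 4 * X * q2 + c * q0 + 6 * q1) * e2

lemma heat_iter (z : ℝ) (m : ℕ) : ∀ t > (0:ℝ),
    iteratedDeriv m (fun s : ℝ => s ^ (-(3:ℝ)/2) * Real.exp (-z / (4*s))) t
      = t ^ (-(3:ℝ)/2 - m) * (heatQ m).eval (z / t) * Real.exp (-z / (4*t)) ∧
    HasDerivAt (fun s : ℝ => s ^ (-(3:ℝ)/2 - m) * (heatQ m).eval (z / s) * Real.exp (-z / (4*s)))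
      (t ^ (-(3:ℝ)/2 - (m+1:ℕ)) * (heatQ (m+1)).eval (z / t) * Real.exp (-z / (4*t))) t := by
  have key : ∀ m : ℕ, ∀ t > (0:ℝ), HasDerivAt
      (fun s : ℝ => s ^ (-(3:ℝ)/2 - m) * (heatQ m).eval (z / s) * Real.exp (-z / (4*s)))
      (t ^ (-(3:ℝ)/2 - (m+1:ℕ)) * (heatQ (m+1)).eval (z / t) * Real.exp (-z / (4*t))) t := by
    intro m t ht
    have h1 : HasDerivAt (fun s : ℝ => s ^ (-(3:ℝ)/2 - m)) _ t :=
      Real.hasDerivAt_rpow_const (Or.inl ht.ne')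
    have h0 : HasDerivAt (fun s : ℝ => z / s) (-z / t^2) t := by
      have := (hasDerivAt_inv ht.ne').const_mul z
      simp only [div_eq_mul_inv]
      exact this.congr_deriv (by ring)
    have h2 : HasDerivAt (fun s : ℝ => (heatQ m).eval (z / s)) _ t :=
      ((heatQ m).hasDerivAt (z / t)).comp t h0
    have h3 : HasDerivAt (fun s : ℝ => Real.exp (-z / (4*s)))
        (Real.exp (-z / (4*t)) * (z / (4 * t^2))) t := by
      have : HasDerivAt (fun s : ℝ => -z / (4*s)) (z / (4 * t^2)) t := by
        have := h0.const_mul (-1/4)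
        have e : (fun s : ℝ => -z / (4*s)) = fun s => -1/4 * (z / s) := by
          funext s; rw [neg_div, mul_comm 4 s, ← div_div]; ring
        rw [e]
        exact this.congr_deriv (by field_simp)
      exact this.exp
    refine ((h1.mul h2).mul h3).congr_deriv ?_
    have e1 : t ^ (-(3:ℝ)/2 - (m+1:ℕ)) = t ^ (-(3:ℝ)/2 - m) / t := by
      rw [← Real.rpow_sub_one ht.ne']; congr 1; push_cast; ring
    have e2 : t ^ (-(3:ℝ)/2 - m - 1) = t ^ (-(3:ℝ)/2 - m) / t := Real.rpow_sub_one ht.ne' _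
    rw [e1, e2]
    simp only [heatQ, Polynomial.eval_sub, Polynomial.eval_mul, Polynomial.eval_C,
      Polynomial.eval_X, Pi.mul_apply]
    field_simp
    ring
  intro t ht
  refine ⟨?_, key m t ht⟩
  induction m generalizing t with
  | zero => simp [heatQ]
  | succ m ih =>
    rw [iteratedDeriv_succ]
    rw [Filter.EventuallyEq.deriv_eq (f := fun s : ℝ => s ^ (-(3:ℝ)/2 - m) *
      (heatQ m).eval (z / s) * Real.exp (-z / (4*s)))]
    · exact (key m t ht).deriv
    · filter_upwards [Ioi_mem_nhds ht] with s hs using ih s hs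

lemma heatUn_eq (m : ℕ) (x t : ℝ) (ht : 0 < t) : heatUn (m+1) x t =
    x / (2 * Real.sqrt Real.pi) *
      (t ^ (-(3:ℝ)/2 - m) * (heatQ m).eval (x^2 / t) * Real.exp (-(x^2) / (4*t))) := by
  rw [heatUn, Nat.add_sub_cancel, (heat_iter (x^2) m t ht).1]

lemma heat_decay (Q : Polynomial ℝ) (a : ℝ) :
    Tendsto (fun w : ℝ => w ^ a * Q.eval w * Real.exp (-(1/4) * w)) atTop (𝓝 0) := by
  induction Q using Polynomial.induction_on' with
  | add p q hp hq =>
    have := hp.add hq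
    rw [add_zero] at this
    refine this.congr fun w => ?_
    rw [Polynomial.eval_add]; ring
  | monomial k c =>
    have := (tendsto_rpow_mul_exp_neg_mul_atTop_nhds_zero (a + k) (1/4) (by norm_num)).const_mul c
    rw [mul_zero] at this
    refine this.congr' ?_
    filter_upwards [eventually_gt_atTop 0] with w hw
    rw [Real.rpow_add hw, Real.rpow_natCast, Polynomial.eval_monomial]; ring

lemma heat_x (m : ℕ) (t : ℝ) (ht : 0 < t) (x : ℝ) :
    iteratedDeriv 2 (fun y : ℝ => y * ((heatQ m).eval (y^2 / t) * Real.exp (-(y^2) / (4*t)))) x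
      = x / t * ((heatQ (m+1)).eval (x^2 / t) * Real.exp (-(x^2) / (4*t))) := by
  have hw : ∀ y : ℝ, HasDerivAt (fun y : ℝ => y^2 / t) (2 * y / t) y := fun y => by
    simpa using (hasDerivAt_pow 2 y).div_const t
  have hE : ∀ y : ℝ, HasDerivAt (fun y : ℝ => Real.exp (-(y^2) / (4*t)))
      (Real.exp (-(y^2) / (4*t)) * (-(2 * y) / (4*t))) y := fun y => by
    simpa using ((hasDerivAt_pow 2 y).neg.div_const (4*t)).exp
  have hP : ∀ (P : Polynomial ℝ) (y : ℝ), HasDerivAt (fun y : ℝ => P.eval (y^2 / t))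
      (P.derivative.eval (y^2/t) * (2 * y / t)) y := fun P y =>
    HasDerivAt.comp (h₂ := fun w => P.eval w) y (P.hasDerivAt (y^2/t)) (hw y)
  set Q := heatQ m with hQ
  set R : Polynomial ℝ := Q + 2 * Polynomial.X * Q.derivative - Polynomial.C (1/2) * Polynomial.X * Q
    with hR
  have d1 : deriv (fun y : ℝ => y * (Q.eval (y^2 / t) * Real.exp (-(y^2) / (4*t))))
      = fun y => R.eval (y^2 / t) * Real.exp (-(y^2) / (4*t)) := by
    ext y
    refine ((hasDerivAt_id y).mul ((hP Q y).mul (hE y))).deriv.trans ?_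
    simp only [hR, Polynomial.eval_sub, Polynomial.eval_add, Polynomial.eval_mul,
      Polynomial.eval_C, Polynomial.eval_X, Polynomial.eval_ofNat, id, Pi.mul_apply]
    field_simp
    ring
  rw [iteratedDeriv_succ, iteratedDeriv_one, d1]
  refine ((hP R x).mul (hE x)).deriv.trans ?_
  have ode := congrArg (Polynomial.eval (x^2/t)) (heatQ_ode m)
  rw [← hQ] at ode
  have d2 : Polynomial.derivative (2 : Polynomial ℝ) = 0 := Polynomial.derivative_ofNat 2
  simp only [hR, heatQ, ← hQ, Polynomial.derivative_sub, Polynomial.derivative_add,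
    Polynomial.derivative_mul, Polynomial.derivative_C, Polynomial.derivative_X, d2,
    Polynomial.eval_sub, Polynomial.eval_add, Polynomial.eval_mul, Polynomial.eval_zero,
    Polynomial.eval_one,
    Polynomial.eval_C, Polynomial.eval_X, Polynomial.eval_ofNat] at ode ⊢
  have hx : ∃ w, w = x^2/t := ⟨_, rfl⟩
  obtain ⟨w, hw⟩ := hx
  rw [← hw] at ode ⊢
  generalize Real.exp (-(x^2) / (4*t)) = E
  have h4 : -(2 * x) / (4*t) = -(1/2) * (x / t) := by field_simp; ring
  have h5 : 2 * x / t = 2 * (x / t) := by ring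
  rw [h4, h5]
  linear_combination (x / t * E) * ode

theorem stmt1 (n : ℕ) (hn : 1 ≤ n) :
    ContDiffOn ℝ (⊤:ℕ∞) (fun p : ℝ × ℝ => heatUn n p.1 p.2) (Ioi (0:ℝ) ×ˢ Ioi (0:ℝ)) ∧
    (∀ x > (0:ℝ), ∀ t > (0:ℝ),
      deriv (fun s => heatUn n x s) t = iteratedDeriv 2 (fun y => heatUn n y t) x) ∧
    (∀ t > (0:ℝ), Tendsto (fun x => heatUn n x t) (𝓝[>] (0:ℝ)) (𝓝 0)) ∧
    (∀ x > (0:ℝ), Tendsto (fun t => heatUn n x t) (𝓝[>] (0:ℝ)) (𝓝 0)) := by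
  obtain ⟨m, rfl⟩ : ∃ m, n = m + 1 := ⟨n - 1, by omega⟩
  refine ⟨?_, ?_, ?_, ?_⟩
  · refine ContDiffOn.congr (f := fun p : ℝ × ℝ => p.1 / (2 * Real.sqrt Real.pi) *
      (p.2 ^ (-(3:ℝ)/2 - m) * (heatQ m).eval (p.1^2 / p.2) * Real.exp (-(p.1^2) / (4*p.2)))) ?_
      (fun p hp => heatUn_eq m p.1 p.2 hp.2)
    intro p hp
    have hp2 : p.2 ≠ 0 := ne_of_gt hp.2
    apply ContDiffAt.contDiffWithinAt
    have hf : ContDiffAt ℝ (⊤:ℕ∞) (fun p : ℝ × ℝ => p.1) p := contDiffAt_fst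
    have hs : ContDiffAt ℝ (⊤:ℕ∞) (fun p : ℝ × ℝ => p.2) p := contDiffAt_snd
    refine (hf.div_const _).mul (((hs.rpow_const_of_ne hp2).mul ?_).mul ?_)
    · have hQ : ContDiff ℝ (⊤:ℕ∞) (fun w : ℝ => (heatQ m).eval w) := by
        simpa using (heatQ m).contDiff_aeval (𝕜 := ℝ) (⊤:ℕ∞)
      exact hQ.contDiffAt.comp p ((hf.pow 2).div hs hp2)
    · exact ((hf.pow 2).neg.div (contDiffAt_const.mul hs) (by positivity)).exp
  · intro x hx t ht
    have h1 : (fun s => heatUn (m+1) x s) =ᶠ[𝓝 t] fun s => x / (2 * Real.sqrt Real.pi) *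
      (s ^ (-(3:ℝ)/2 - m) * (heatQ m).eval (x^2 / s) * Real.exp (-(x^2) / (4*s))) := by
      filter_upwards [Ioi_mem_nhds ht] with s hs using heatUn_eq m x s hs
    rw [h1.deriv_eq, ((heat_iter (x^2) m t ht).2.const_mul _).deriv]
    have h2 : (fun y => heatUn (m+1) y t) = fun y => (t ^ (-(3:ℝ)/2 - m) / (2 * Real.sqrt Real.pi)) *
        (y * ((heatQ m).eval (y^2 / t) * Real.exp (-(y^2) / (4*t)))) := by
      ext y; rw [heatUn_eq m y t ht]; ring
    rw [h2, iteratedDeriv_const_mul_field, heat_x m t ht x]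
    have e1 : t ^ (-(3:ℝ)/2 - (m+1:ℕ)) = t ^ (-(3:ℝ)/2 - m) / t := by
      rw [← Real.rpow_sub_one ht.ne']; congr 1; push_cast; ring
    rw [e1]; ring
  · intro t ht
    have h2 : (fun y => heatUn (m+1) y t) = fun y => y / (2 * Real.sqrt Real.pi) *
      (t ^ (-(3:ℝ)/2 - m) * (heatQ m).eval (y^2 / t) * Real.exp (-(y^2) / (4*t))) := by
      ext y; rw [heatUn_eq m y t ht]
    rw [h2]
    have hc : Continuous (fun y : ℝ => y / (2 * Real.sqrt Real.pi) *
      (t ^ (-(3:ℝ)/2 - m) * (heatQ m).eval (y^2 / t) * Real.exp (-(y^2) / (4*t)))) := by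
      have := (heatQ m).continuous
      fun_prop
    have := hc.tendsto 0
    simp only [zero_div, zero_mul] at this
    exact this.mono_left nhdsWithin_le_nhds
  · intro x hx
    have hx2 : 0 < x^2 := by positivity
    have hlim : Tendsto (fun t : ℝ => x^2 / t) (𝓝[>] 0) atTop := by
      simp only [div_eq_mul_inv]
      exact tendsto_inv_nhdsGT_zero.const_mul_atTop hx2
    have := ((heat_decay (heatQ m) (3/2 + m)).comp hlim).const_mul
      (x / (2 * Real.sqrt Real.pi) * (x^2) ^ (-(3:ℝ)/2 - m))
    rw [mul_zero] at this
    refine this.congr' ?_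
    filter_upwards [self_mem_nhdsWithin] with t ht
    have ht : 0 < t := ht
    rw [heatUn_eq m x t ht]
    have e1 : (x^2 / t) ^ ((3:ℝ)/2 + m) = t ^ (-(3:ℝ)/2 - m) / (x^2) ^ (-(3:ℝ)/2 - m) := by
      rw [← Real.div_rpow ht.le hx2.le, ← inv_div, Real.inv_rpow (by positivity),
        ← Real.rpow_neg (by positivity)]
      congr 1; ring
    have e2 : -(1/4) * (x^2 / t) = -(x^2) / (4*t) := by field_simp
    have hne : (x^2) ^ (-(3:ℝ)/2 - m) ≠ 0 := (Real.rpow_pos_of_pos hx2 _).ne'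
    simp only [Function.comp, e1, e2]
    generalize (x^2) ^ (-(3:ℝ)/2 - m) = A at *
    field_simp
end

section
/- Define v(x,t) := (i/π) · lim_{R→∞} ∫_{−R}^{R} e^{iλx} (e^{−λ²t} − 1) λ^{−1} dλ for (x,t) ∈ Q (the symmetric improper integral exists for every x > 0, t > 0; the integrand extends continuously by the value 0 at λ = 0). Then v is real-valued and smooth on Q, satisfies the heat equation v_t = v_{xx} on Q, and satisfies lim_{x→0⁺} v(x,t) = 1 for every t > 0 and lim_{t→0⁺} v(x,t) = 0 for every x > 0. -/
open MeasureTheory Filter Set Topology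

/-- The symmetric partial integral `∫_{−R}^{R} e^{iλx} (e^{−λ²t} − 1) λ^{−1} dλ`.
(The integrand's junk value `0` at `λ = 0` agrees with its continuous extension.) -/
noncomputable def heatVPartial (x t R : ℝ) : ℂ :=
  ∫ l in (-R)..R,
    Complex.exp (Complex.I * (l:ℂ) * (x:ℂ)) * (Complex.exp (-(l:ℂ)^2 * (t:ℂ)) - 1) / (l:ℂ)

open Real in
theorem aux_bd (R s : ℝ) :
    ‖exp (-(R * s)) * (cos R + s * sin R) * (1 + s^2)⁻¹‖ ≤ 2 * exp (-(R * s)) := by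
  have hs : 0 < 1 + s^2 := by positivity
  rw [norm_mul, norm_mul, norm_eq_abs, norm_eq_abs, norm_eq_abs, abs_exp,
    abs_of_pos (inv_pos.2 hs), mul_assoc, mul_comm 2]
  refine mul_le_mul_of_nonneg_left ?_ (exp_pos _).le
  rw [← div_eq_mul_inv, div_le_iff₀ hs]
  have h1 := abs_cos_le_one R
  have h2 := abs_sin_le_one R
  have h3 : |s * sin R| ≤ |s| := by
    rw [abs_mul]; exact mul_le_of_le_one_right (abs_nonneg _) h2
  have h4 := abs_add_le (cos R) (s * sin R)
  nlinarith [sq_nonneg (|s| - 1), sq_abs s]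

open Real in
theorem aux_inner (R s : ℝ) :
    ∫ l in (0:ℝ)..R, sin l * exp (-(l * s)) =
      (1 + s^2)⁻¹ - exp (-(R * s)) * (cos R + s * sin R) * (1 + s^2)⁻¹ := by
  have hs : (1 + s^2) ≠ 0 := by positivity
  have h : ∀ l ∈ uIcc 0 R, HasDerivAt
      (fun l : ℝ => - (exp (-(l * s)) * (cos l + s * sin l) * (1 + s^2)⁻¹))
      (sin l * exp (-(l * s))) l := by
    intro l _
    have h1 : HasDerivAt (fun l : ℝ => exp (-(l * s))) (exp (-(l*s)) * (-(1 * s))) l :=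
      (((hasDerivAt_id l).mul_const s).neg).exp
    have h2 : HasDerivAt (fun l : ℝ => cos l + s * sin l) (-sin l + s * cos l) l :=
      (hasDerivAt_cos l).add ((hasDerivAt_sin l).const_mul s)
    refine HasDerivAt.congr_deriv ((h1.mul h2).mul_const ((1 + s^2)⁻¹)).neg ?_
    field_simp
    ring
  rw [intervalIntegral.integral_eq_sub_of_hasDerivAt h
    (Continuous.intervalIntegrable (by fun_prop) _ _)]
  simp
  ring

open Real in
theorem aux_dirichlet_fin {R : ℝ} (hR : 0 < R) :
    ∫ l in (0:ℝ)..R, sinc l =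
      π / 2 - ∫ s in Ioi (0:ℝ), exp (-(R * s)) * (cos R + s * sin R) * (1 + s^2)⁻¹ := by
  have hexp : ∀ l : ℝ, 0 < l → ∫ s in Ioi (0:ℝ), exp (-(l * s)) = l⁻¹ := by
    intro l hl
    have := integral_exp_mul_Ioi (a := -l) (by linarith) 0
    simp only [neg_mul] at this
    rw [this]; simp
  have hexpI : ∀ l : ℝ, 0 < l → IntegrableOn (fun s => exp (-(l * s))) (Ioi (0:ℝ)) := by
    intro l hl
    have := integrableOn_exp_mul_Ioi (a := -l) (by linarith) 0
    simpa only [neg_mul] using this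
  have h1 : ∫ l in (0:ℝ)..R, sinc l =
      ∫ l in (0:ℝ)..R, ∫ s in Ioi (0:ℝ), sin l * exp (-(l * s)) := by
    refine intervalIntegral.integral_congr_ae (ae_of_all _ ?_)
    intro l hl
    rw [uIoc_of_le hR.le] at hl
    rw [integral_const_mul, hexp l hl.1, sinc_of_ne_zero hl.1.ne', div_eq_mul_inv]
  have hint : Integrable (Function.uncurry fun l s => sin l * exp (-(l * s)))
      ((volume.restrict (Ioc 0 R)).prod (volume.restrict (Ioi (0:ℝ)))) := by
    rw [integrable_prod_iff (by
      apply Continuous.aestronglyMeasurable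
      unfold Function.uncurry
      fun_prop)]
    constructor
    · filter_upwards [ae_restrict_mem measurableSet_Ioc] with l hl
      exact (hexpI l hl.1).const_mul (sin l)
    · have : IntegrableOn (fun l => |sinc l|) (Ioc 0 R) :=
        (continuous_sinc.abs.integrableOn_Icc).mono_set Ioc_subset_Icc_self
      refine this.congr ?_
      filter_upwards [ae_restrict_mem measurableSet_Ioc] with l hl
      simp only [Function.uncurry, norm_mul, norm_eq_abs, abs_exp]
      rw [integral_const_mul, hexp l hl.1, sinc_of_ne_zero hl.1.ne', div_eq_mul_inv, abs_mul,
        abs_of_pos (inv_pos.2 hl.1)]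
  have hI1 : IntegrableOn (fun s : ℝ => (1 + s^2)⁻¹) (Ioi 0) :=
    integrable_inv_one_add_sq.integrableOn
  have hI2 : IntegrableOn (fun s : ℝ => exp (-(R * s)) * (cos R + s * sin R) * (1 + s^2)⁻¹) (Ioi 0) := by
    refine ((hexpI R hR).const_mul 2).mono' (by
      apply Continuous.aestronglyMeasurable
      have : ∀ s : ℝ, (1 + s^2) ≠ 0 := fun s => by positivity
      fun_prop (disch := assumption)) (ae_of_all _ fun s => aux_bd R s)
  rw [h1, intervalIntegral_integral_swap (by rwa [uIoc_of_le hR.le])]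
  simp_rw [aux_inner]
  rw [integral_sub hI1 hI2]
  congr 1
  simpa using integral_Ioi_inv_one_add_sq (i := 0)

open Real in
theorem aux_dirichlet :
    Tendsto (fun R : ℝ => ∫ l in (0:ℝ)..R, sinc l) atTop (𝓝 (π / 2)) := by
  have h0 : Tendsto (fun R : ℝ => ∫ s in Ioi (0:ℝ),
      exp (-(R * s)) * (cos R + s * sin R) * (1 + s^2)⁻¹) atTop (𝓝 0) := by
    refine squeeze_zero_norm' (a := fun R : ℝ => 2 * R⁻¹) ?_
      (by simpa using tendsto_inv_atTop_zero.const_mul (2:ℝ))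
    filter_upwards [eventually_gt_atTop 0] with R hR
    have hi := integrableOn_exp_mul_Ioi (a := -R) (by linarith) 0
    have hv := integral_exp_mul_Ioi (a := -R) (by linarith) 0
    simp only [neg_mul] at hi hv
    refine (norm_integral_le_of_norm_le (hi.const_mul 2)
      (ae_of_all _ fun s => aux_bd R s)).trans ?_
    rw [integral_const_mul, hv]
    simp
  have h1 := (tendsto_const_nhds (x := π / 2)).sub h0
  rw [sub_zero] at h1
  refine h1.congr' ?_
  filter_upwards [eventually_gt_atTop 0] with R hR
  exact (aux_dirichlet_fin hR).symm

open Real in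
theorem aux_dirichlet_sym {x : ℝ} (hx : 0 < x) :
    Tendsto (fun R : ℝ => ∫ l in (-R)..R, x * sinc (l * x)) atTop (𝓝 π) := by
  have h : ∀ R : ℝ, ∫ l in (-R)..R, x * sinc (l * x) = 2 * ∫ l in (0:ℝ)..(R * x), sinc l := by
    intro R
    rw [intervalIntegral.integral_const_mul, intervalIntegral.mul_integral_comp_mul_right]
    have hI : ∀ a b : ℝ, IntervalIntegrable sinc volume a b :=
      fun a b => continuous_sinc.intervalIntegrable a b
    rw [← intervalIntegral.integral_add_adjacent_intervals (hI _ 0) (hI 0 _)]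
    have := intervalIntegral.integral_comp_neg (a := 0) (b := R * x) sinc
    simp only [sinc_neg, neg_zero] at this
    rw [neg_mul, ← this]; ring
  simp_rw [h]
  have := (aux_dirichlet.comp (tendsto_id.atTop_mul_const hx)).const_mul 2
  simpa [mul_div_cancel₀] using this

/-- Unnormalised error function. -/
noncomputable def auxE (z : ℝ) : ℝ := ∫ s in (0:ℝ)..z, Real.exp (-s^2)

open Real in
theorem aux_gauss_cos {t : ℝ} (ht : 0 < t) (y : ℝ) :
    ∫ l : ℝ, cos (l * y) * exp (-l^2 * t) = √(π / t) * exp (-(y / (2 * √t))^2) := by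
  have h := fourierIntegral_gaussian (b := (t:ℂ)) (by simpa using ht) (y:ℂ)
  have hint : Integrable fun l : ℝ => Complex.exp (Complex.I * y * l) * Complex.exp (-t * (l:ℂ)^2) := by
    refine (integrable_exp_neg_mul_sq ht).mono' (by fun_prop) (ae_of_all _ fun l => ?_)
    rw [norm_mul, Complex.norm_exp, Complex.norm_exp]
    simp [← Complex.ofReal_pow]
  have h2 := congrArg Complex.re h
  rw [← RCLike.re_eq_complex_re, ← integral_re hint] at h2
  have h3 : ((π:ℂ) / t) ^ (1 / 2 : ℂ) = ((√(π / t) : ℝ) : ℂ) := by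
    rw [sqrt_eq_rpow, Complex.ofReal_cpow (by positivity)]; push_cast; rfl
  rw [h3] at h2
  have h4 : Complex.exp (-(y:ℂ)^2 / (4 * t)) = ((exp (-(y / (2 * √t))^2) : ℝ) : ℂ) := by
    rw [div_pow, mul_pow, sq_sqrt ht.le]; push_cast; congr 1; ring
  rw [h4, ← Complex.ofReal_mul] at h2
  rw [RCLike.re_eq_complex_re, Complex.ofReal_re] at h2
  rw [← h2]
  refine integral_congr_ae (ae_of_all _ fun l => ?_)
  simp only
  have e1 : Complex.exp (-t * (l:ℂ)^2) = ((exp (-l^2 * t) : ℝ) : ℂ) := by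
    push_cast; congr 1; ring
  have e2 : Complex.I * y * l = ((l * y : ℝ) : ℂ) * Complex.I := by push_cast; ring
  rw [e1, e2, Complex.re_mul_ofReal, Complex.exp_ofReal_mul_I_re]

open Real in
theorem aux_gauss_sinc_integrable {t : ℝ} (ht : 0 < t) (x : ℝ) :
    Integrable fun l : ℝ => x * sinc (l * x) * exp (-l^2 * t) := by
  refine ((integrable_exp_neg_mul_sq ht).const_mul |x|).mono'
    (by have := continuous_sinc; fun_prop) (ae_of_all _ fun l => ?_)
  rw [norm_mul, norm_mul, norm_eq_abs, norm_eq_abs, norm_eq_abs, abs_exp,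
    show -l^2 * t = -t * l^2 by ring]
  gcongr
  exact mul_le_of_le_one_right (abs_nonneg _) (abs_sinc_le_one _)

open Real in
theorem aux_gauss_sinc {t : ℝ} (ht : 0 < t) (x : ℝ) :
    ∫ l : ℝ, x * sinc (l * x) * exp (-l^2 * t) = 2 * √π * auxE (x / (2 * √t)) := by
  have h1 : ∀ l : ℝ, x * sinc (l * x) * exp (-l^2 * t) =
      ∫ y in (0:ℝ)..x, cos (l * y) * exp (-l^2 * t) := by
    intro l
    rw [intervalIntegral.integral_mul_const]
    congr 1
    by_cases hl : l = 0
    · simp [hl]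
    rw [intervalIntegral.integral_comp_mul_left (fun y => cos y) hl, integral_cos]
    by_cases hx : x = 0
    · simp [hx]
    rw [sinc_of_ne_zero (mul_ne_zero hl hx)]
    simp
    field_simp
  have hint : Integrable (Function.uncurry fun y l => cos (l * y) * exp (-l^2 * t))
      ((volume.restrict (uIoc 0 x)).prod (volume : Measure ℝ)) := by
    have hg := Integrable.mul_prod (μ := volume.restrict (uIoc 0 x)) (ν := (volume : Measure ℝ))
      (f := fun _ : ℝ => (1:ℝ)) (g := fun l => exp (-t * l^2))
      (by rw [uIoc]; exact integrable_const _) (integrable_exp_neg_mul_sq ht)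
    refine hg.mono' (by
      apply Continuous.aestronglyMeasurable
      unfold Function.uncurry
      fun_prop) (ae_of_all _ fun p => ?_)
    simp only [Function.uncurry, norm_mul, norm_eq_abs, abs_exp]
    rw [show -p.2^2 * t = -t * p.2^2 by ring]
    gcongr
    exact abs_cos_le_one _
  simp_rw [h1]
  rw [← intervalIntegral_integral_swap hint]
  simp_rw [aux_gauss_cos ht]
  have hst : 0 < √t := sqrt_pos.2 ht
  rw [intervalIntegral.integral_const_mul,
    intervalIntegral.integral_comp_div (fun y => exp (-y^2)) (by positivity : 2 * √t ≠ 0),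
    sqrt_div pi_pos.le]
  simp [auxE]
  field_simp

open Real in
theorem aux_partial (x : ℝ) {t R : ℝ} (ht : 0 < t) :
    heatVPartial x t R = Complex.I *
      (((∫ l in (-R)..R, x * sinc (l * x) * exp (-l^2 * t)) -
        ∫ l in (-R)..R, x * sinc (l * x) : ℝ) : ℂ) := by
  set f : ℝ → ℂ := fun l =>
    Complex.exp (Complex.I * (l:ℂ) * (x:ℂ)) * (Complex.exp (-(l:ℂ)^2 * (t:ℂ)) - 1) / (l:ℂ) with hf
  have hfm : Measurable f := by fun_prop
  have hfb : ∀ l, ‖f l‖ ≤ |l| * t := by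
    intro l
    have e1 : Complex.I * (l:ℂ) * (x:ℂ) = ((l * x : ℝ) : ℂ) * Complex.I := by push_cast; ring
    have e2 : Complex.exp (-(l:ℂ)^2 * (t:ℂ)) - 1 = ((exp (-l^2 * t) - 1 : ℝ) : ℂ) := by push_cast; rfl
    simp only [hf]
    rw [e1, e2, norm_div, norm_mul, Complex.norm_exp_ofReal_mul_I, one_mul, Complex.norm_real,
      Complex.norm_real, norm_eq_abs, norm_eq_abs]
    refine div_le_of_le_mul₀ (abs_nonneg _) (by positivity) ?_
    have h1 : exp (-l^2 * t) ≤ 1 := exp_le_one_iff.2 (by nlinarith [sq_nonneg l, mul_nonneg (sq_nonneg l) ht.le])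
    have h2 := add_one_le_exp (-l^2 * t)
    rw [abs_of_nonpos (by linarith)]
    nlinarith [sq_abs l]
  have hfi : ∀ a b : ℝ, IntervalIntegrable f volume a b := by
    intro a b
    have : IntervalIntegrable (fun l : ℝ => |l| * t) volume a b :=
      Continuous.intervalIntegrable (by fun_prop) _ _
    exact this.mono_fun' hfm.aestronglyMeasurable (ae_of_all _ hfb)
  have hneg : ∫ l in (-R)..R, f (-l) = ∫ l in (-R)..R, f l := by
    rw [intervalIntegral.integral_comp_neg]; simp
  have hfn : IntervalIntegrable (fun l => f (-l)) volume (-R) R := by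
    have := (hfi R (-R)).comp_sub_left 0
    simpa using this
  have hsum : ∀ l, f l + f (-l) = Complex.I * ((2 * (x * sinc (l * x) * exp (-l^2 * t) - x * sinc (l * x)) : ℝ) : ℂ) := by
    intro l
    by_cases hl : l = 0
    · simp [hf, hl]
    by_cases hx : x = 0
    · simp [hf, hx, neg_div, div_neg]
    have hlC : (l:ℂ) ≠ 0 := by exact_mod_cast hl
    have hxC : (x:ℂ) ≠ 0 := by exact_mod_cast hx
    rw [sinc_of_ne_zero (mul_ne_zero hl hx)]
    have e1 : Complex.exp (Complex.I * (l:ℂ) * (x:ℂ)) = Complex.cos (l*x) + Complex.sin (l*x) * Complex.I := by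
      rw [← Complex.exp_mul_I]; congr 1; ring
    have e2 : Complex.exp (Complex.I * ((-l : ℝ):ℂ) * (x:ℂ)) = Complex.cos (l*x) - Complex.sin (l*x) * Complex.I := by
      have := Complex.exp_mul_I (-((l:ℂ)*x))
      rw [Complex.cos_neg, Complex.sin_neg] at this
      rw [sub_eq_add_neg, ← neg_mul, ← this]; congr 1; push_cast; ring
    simp only [hf]
    rw [e1, e2]
    push_cast
    rw [neg_sq]
    field_simp
    ring
  have key : 2 * ∫ l in (-R)..R, f l = ∫ l in (-R)..R, (f l + f (-l)) := by
    rw [intervalIntegral.integral_add (hfi _ _) hfn, hneg, two_mul]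
  simp_rw [hsum] at key
  rw [intervalIntegral.integral_const_mul, intervalIntegral.integral_ofReal,
    intervalIntegral.integral_const_mul, intervalIntegral.integral_sub
      (Continuous.intervalIntegrable (by have := continuous_sinc; fun_prop) _ _)
      (Continuous.intervalIntegrable (by have := continuous_sinc; fun_prop) _ _)] at key
  have : heatVPartial x t R = ∫ l in (-R)..R, f l := rfl
  rw [this]
  apply mul_left_cancel₀ (two_ne_zero : (2:ℂ) ≠ 0)
  rw [key]; push_cast; ring

/-- The closed form of the solution: complementary error function. -/
noncomputable def auxV (x t : ℝ) : ℝ := 1 - 2 / √Real.pi * auxE (x / (2 * √t))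

open Real in
theorem aux_partial_tendsto {x t : ℝ} (hx : 0 < x) (ht : 0 < t) :
    Tendsto (fun R : ℝ => heatVPartial x t R) atTop
      (𝓝 (Complex.I * ((2 * √π * auxE (x / (2 * √t)) - π : ℝ) : ℂ))) := by
  simp_rw [aux_partial x ht]
  have h1 := intervalIntegral_tendsto_integral (aux_gauss_sinc_integrable ht x)
    tendsto_neg_atTop_atBot tendsto_id
  rw [aux_gauss_sinc ht] at h1
  have h2 := h1.sub (aux_dirichlet_sym hx)
  exact ((Complex.continuous_ofReal.tendsto _).comp h2).const_mul _

open Real in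
theorem aux_v_tendsto {x t : ℝ} (hx : 0 < x) (ht : 0 < t) :
    Tendsto (fun R : ℝ => (Complex.I / (Real.pi : ℂ)) * heatVPartial x t R)
          atTop (𝓝 ((auxV x t : ℝ) : ℂ)) := by
  have h := (aux_partial_tendsto hx ht).const_mul (Complex.I / (Real.pi : ℂ))
  convert h using 2
  have hp : (π : ℂ) ≠ 0 := by exact_mod_cast pi_ne_zero
  have hq : (√π : ℂ) ≠ 0 := by exact_mod_cast (sqrt_pos.2 pi_pos).ne'
  have hs : (π : ℂ) = (√π : ℂ)^2 := by exact_mod_cast (sq_sqrt pi_pos.le).symm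
  have hI : Complex.I / (π:ℂ) * (Complex.I * ((2 * √π * auxE (x / (2 * √t)) - π : ℝ) : ℂ)) =
    - ((2 * √π * auxE (x / (2 * √t)) - π : ℝ) : ℂ) / π := by
    rw [div_mul_eq_mul_div, ← mul_assoc, Complex.I_mul_I]; ring
  rw [hI, auxV]
  push_cast
  rw [hs]
  field_simp
  ring

open Real in
theorem auxE_hasDerivAt (z : ℝ) : HasDerivAt auxE (exp (-z^2)) z := by
  have hc : Continuous fun s : ℝ => exp (-s^2) := by fun_prop
  exact intervalIntegral.integral_hasDerivAt_right (hc.intervalIntegrable _ _)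
    (hc.stronglyMeasurableAtFilter _ _) hc.continuousAt

theorem auxE_contDiff : ContDiff ℝ (⊤:ℕ∞) auxE := by
  rw [contDiff_infty_iff_deriv]
  refine ⟨fun z => (auxE_hasDerivAt z).differentiableAt, ?_⟩
  have : deriv auxE = fun z => Real.exp (-z^2) := funext fun z => (auxE_hasDerivAt z).deriv
  rw [this]
  fun_prop

open Real in
theorem auxE_tendsto : Tendsto auxE atTop (𝓝 (√π / 2)) := by
  have hi : Integrable fun s : ℝ => exp (-s^2) := by
    simpa using integrable_exp_neg_mul_sq (b := 1) one_pos
  have h := intervalIntegral_tendsto_integral_Ioi 0 hi.integrableOn tendsto_id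
  have h2 := integral_gaussian_Ioi 1
  simp only [neg_mul, one_mul, div_one] at h2
  rw [h2] at h
  exact h

theorem auxV_contDiffOn :
    ContDiffOn ℝ (⊤:ℕ∞) (fun p : ℝ × ℝ => auxV p.1 p.2) (Ioi (0:ℝ) ×ˢ Ioi (0:ℝ)) := by
  intro p hp
  have hp2 : (0:ℝ) < p.2 := hp.2
  have hs : 0 < √p.2 := Real.sqrt_pos.2 hp2
  apply ContDiffAt.contDiffWithinAt
  unfold auxV
  refine contDiffAt_const.sub (contDiffAt_const.mul ?_)
  refine auxE_contDiff.contDiffAt.comp p ?_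
  refine contDiffAt_fst.div (contDiffAt_const.mul (contDiffAt_snd.sqrt hp2.ne')) (by positivity)

open Real in
theorem auxV_hasDerivAt_x (x : ℝ) {t : ℝ} (ht : 0 < t) :
    HasDerivAt (fun y => auxV y t) (-(exp (-(x / (2 * √t))^2) / (√π * √t))) x := by
  have hs : 0 < √t := sqrt_pos.2 ht
  have h1 : HasDerivAt (fun y : ℝ => y / (2 * √t)) (1 / (2 * √t)) x :=
    (hasDerivAt_id x).div_const _
  have h2 := (((auxE_hasDerivAt _).comp x h1).const_mul (2 / √π)).const_sub 1
  refine h2.congr_deriv ?_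
  have : 0 < √π := sqrt_pos.2 pi_pos
  field_simp

open Real in
theorem auxV_heat (x : ℝ) {t : ℝ} (ht : 0 < t) : ∃ d : ℝ,
    HasDerivAt (fun s => auxV x s) d t ∧
    HasDerivAt (fun y => (-(exp (-(y / (2 * √t))^2) / (√π * √t)))) d x := by
  have hs : 0 < √t := sqrt_pos.2 ht
  have hp : 0 < √π := sqrt_pos.2 pi_pos
  refine ⟨x * exp (-(x / (2 * √t))^2) / (2 * √π * √t ^ 3), ?_, ?_⟩
  · have h1 : HasDerivAt (fun s : ℝ => x / (2 * √s)) ((0 * (2 * √t) - x * (2 * (1 / (2 * √t)))) / (2 * √t)^2) t :=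
      (hasDerivAt_const t x).div ((hasDerivAt_sqrt ht.ne').const_mul 2) (by positivity)
    have h2 := (((auxE_hasDerivAt _).comp t h1).const_mul (2 / √π)).const_sub 1
    refine h2.congr_deriv ?_
    field_simp
    ring
  · have h1 : HasDerivAt (fun y : ℝ => y / (2 * √t)) (1 / (2 * √t)) x :=
      (hasDerivAt_id x).div_const _
    have h2 := (((h1.pow 2).neg.exp).div_const (√π * √t)).neg
    refine h2.congr_deriv ?_
    simp
    field_simp

theorem stmt3 :
    (∀ x > (0:ℝ), ∀ t > (0:ℝ), ∃ L : ℂ,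
      Tendsto (fun R : ℝ => heatVPartial x t R) atTop (𝓝 L)) ∧
    ∀ v : ℝ → ℝ → ℂ,
      (∀ x > (0:ℝ), ∀ t > (0:ℝ),
        Tendsto (fun R : ℝ => (Complex.I / (Real.pi : ℂ)) * heatVPartial x t R)
          atTop (𝓝 (v x t))) →
      (∀ x > (0:ℝ), ∀ t > (0:ℝ), (v x t).im = 0) ∧
      ContDiffOn ℝ (⊤:ℕ∞) (fun p : ℝ × ℝ => v p.1 p.2) (Ioi (0:ℝ) ×ˢ Ioi (0:ℝ)) ∧
      (∀ x > (0:ℝ), ∀ t > (0:ℝ),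
        deriv (fun s => v x s) t = iteratedDeriv 2 (fun y => v y t) x) ∧
      (∀ t > (0:ℝ), Tendsto (fun x => v x t) (𝓝[>] (0:ℝ)) (𝓝 1)) ∧
      (∀ x > (0:ℝ), Tendsto (fun t => v x t) (𝓝[>] (0:ℝ)) (𝓝 0)) := by
  refine ⟨fun x hx t ht => ⟨_, aux_partial_tendsto hx ht⟩, fun v hv => ?_⟩
  have hvV : ∀ x > (0:ℝ), ∀ t > (0:ℝ), v x t = ((auxV x t : ℝ) : ℂ) := fun x hx t ht =>
    tendsto_nhds_unique (hv x hx t ht) (aux_v_tendsto hx ht)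
  refine ⟨fun x hx t ht => ?_, ?_, fun x hx t ht => ?_, fun t ht => ?_, fun x hx => ?_⟩
  · rw [hvV x hx t ht, Complex.ofReal_im]
  · exact (Complex.ofRealCLM.contDiff.comp_contDiffOn auxV_contDiffOn).congr
      fun p hp => hvV p.1 hp.1 p.2 hp.2
  · obtain ⟨d, h1, h2⟩ := auxV_heat x ht
    have e1 : (fun s => v x s) =ᶠ[𝓝 t] fun s => ((auxV x s : ℝ) : ℂ) := by
      filter_upwards [Ioi_mem_nhds ht] with s hs using hvV x hx s hs
    have e2 : deriv (fun y => v y t) =ᶠ[𝓝 x]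
        fun y => ((-(Real.exp (-(y / (2 * √t))^2) / (√Real.pi * √t)) : ℝ) : ℂ) := by
      filter_upwards [Ioi_mem_nhds hx] with y hy
      have e : (fun y => v y t) =ᶠ[𝓝 y] fun y => ((auxV y t : ℝ) : ℂ) := by
        filter_upwards [Ioi_mem_nhds hy] with z hz using hvV z hz t ht
      rw [e.deriv_eq]
      exact (auxV_hasDerivAt_x y ht).ofReal_comp.deriv
    rw [e1.deriv_eq, h1.ofReal_comp.deriv, iteratedDeriv_succ, iteratedDeriv_one, e2.deriv_eq,
      h2.ofReal_comp.deriv]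
  · have hc : Tendsto (fun x => auxV x t) (𝓝[>] (0:ℝ)) (𝓝 1) := by
      have := ((auxV_hasDerivAt_x 0 ht).continuousAt.tendsto).mono_left
        (nhdsWithin_le_nhds (s := Ioi (0:ℝ)))
      simpa [auxV, auxE] using this
    have h := (Complex.continuous_ofReal.tendsto _).comp hc
    rw [Complex.ofReal_one] at h
    refine h.congr' ?_
    filter_upwards [self_mem_nhdsWithin] with x hx using (hvV x hx t ht).symm
  · have hc : Tendsto (fun t => auxV x t) (𝓝[>] (0:ℝ)) (𝓝 0) := by
      have h1 : Tendsto (fun t : ℝ => 2 * √t) (𝓝[>] (0:ℝ)) (𝓝[>] (0:ℝ)) := by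
        refine tendsto_nhdsWithin_iff.2 ⟨?_, ?_⟩
        · have : Continuous fun t : ℝ => 2 * √t := by fun_prop
          have := (this.tendsto 0).mono_left (nhdsWithin_le_nhds (s := Ioi (0:ℝ)))
          simpa using this
        · filter_upwards [self_mem_nhdsWithin] with t ht
          have : 0 < √t := Real.sqrt_pos.2 ht
          exact mul_pos two_pos this
      have h2 : Tendsto (fun t : ℝ => x / (2 * √t)) (𝓝[>] (0:ℝ)) atTop := by
        simp_rw [div_eq_mul_inv]
        exact (tendsto_inv_nhdsGT_zero.comp h1).const_mul_atTop hx
      have h3 := ((auxE_tendsto.comp h2).const_mul (2 / √Real.pi)).const_sub 1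
      have hp : 0 < √Real.pi := Real.sqrt_pos.2 Real.pi_pos
      rw [show 1 - 2 / √Real.pi * (√Real.pi / 2) = 0 by field_simp; ring] at h3
      exact h3
    have h := (Complex.continuous_ofReal.tendsto _).comp hc
    rw [Complex.ofReal_zero] at h
    refine h.congr' ?_
    filter_upwards [self_mem_nhdsWithin] with t ht using (hvV x hx t ht).symm
end

section
/- Fix ε > 0 and define u(x,t) := −(9/(2π)) ∫_{−∞}^{∞} e^{i(ξ+iε)x + i(ξ+iε)³ t} (ξ+iε)² dξ for (x,t) ∈ Q (the integral is absolutely convergent for t > 0). Then u is smooth on Q, satisfies the linearized Korteweg–de Vries (Airy) equation u_t = −u_{xxx} at every point of Q, satisfies lim_{x→0⁺} u(x,t) = 0 for every t > 0 and lim_{t→0⁺} u(x,t) = 0 for every x > 0, and u is not identically zero on Q. Consequently, the homogeneous Dirichlet initial-boundary-value problem for the equation u_t = −u_{xxx} on the quarter-plane does not have a unique solution. -/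
open MeasureTheory Filter Set Topology

/-- The point `λ = ξ + iε` on the line `Im λ = ε`. -/
noncomputable def lamC (ε ξ : ℝ) : ℂ := (ξ:ℂ) + Complex.I * (ε:ℂ)

/-- `u(x,t) = −(9/(2π)) ∫_{Im λ = ε} e^{iλx + iλ³t} λ² dλ`. -/
noncomputable def kdvUeps (ε x t : ℝ) : ℂ :=
  -(9 / (2 * (Real.pi : ℂ))) *
    ∫ ξ : ℝ, Complex.exp (Complex.I * lamC ε ξ * (x:ℂ) + Complex.I * (lamC ε ξ)^3 * (t:ℂ))
      * (lamC ε ξ)^2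

/-- A function `u` solves the homogeneous Dirichlet IBVP for the linearized KdV
equation `u_t = −u_{xxx}` on the open quarter-plane `Q = (0,∞) × (0,∞)`, with zero
boundary limits. -/
def SolvesHomLKdV (u : ℝ → ℝ → ℂ) : Prop :=
  ContDiffOn ℝ (⊤:ℕ∞) (fun p : ℝ × ℝ => u p.1 p.2) (Ioi (0:ℝ) ×ˢ Ioi (0:ℝ)) ∧
  (∀ x > (0:ℝ), ∀ t > (0:ℝ),
    deriv (fun s => u x s) t = -(iteratedDeriv 3 (fun y => u y t) x)) ∧
  (∀ t > (0:ℝ), Tendsto (fun x => u x t) (𝓝[>] (0:ℝ)) (𝓝 0)) ∧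
  (∀ x > (0:ℝ), Tendsto (fun t => u x t) (𝓝[>] (0:ℝ)) (𝓝 0))


noncomputable def airyE (a : ℝ) (z : ℂ) (ξ : ℝ) : ℂ :=
  Complex.exp (Complex.I * lamC a ξ * z + Complex.I * (lamC a ξ)^3)

noncomputable def airyG (k : ℕ) (z : ℂ) : ℂ := ∫ ξ : ℝ, (lamC 1 ξ)^k * airyE 1 z ξ

lemma lamC_norm_le (a ξ : ℝ) (ha : 0 ≤ a) : ‖lamC a ξ‖ ≤ |ξ| + a := by
  unfold lamC
  refine (norm_add_le _ _).trans ?_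
  simp [abs_of_nonneg ha]

lemma re_I_lamC_cube (a ξ : ℝ) : (Complex.I * (lamC a ξ)^3).re = a^3 - 3 * a * ξ^2 := by
  simp [lamC, pow_succ]
  ring

lemma airyE_bound (c b R : ℝ) (k : ℕ) (hc : 0 < c) (hR : 0 ≤ R) :
    ∃ C : ℝ, ∀ a z ξ, c ≤ a → a ≤ b → ‖z‖ ≤ R →
      ‖(lamC a ξ)^k * airyE a z ξ‖ ≤ C * Real.exp (-c * ξ^2) := by
  refine ⟨k.factorial * Real.exp (b * (R+1) + b^3 + (R+1)^2/(4*c)), ?_⟩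
  intro a z ξ hca hab hz
  have ha : 0 < a := hc.trans_le hca
  have hl := lamC_norm_le a ξ ha.le
  have h1 : ‖lamC a ξ‖^k ≤ k.factorial * Real.exp (|ξ| + a) := by
    have h2 := Real.pow_div_factorial_le_exp (x := |ξ| + a) (by positivity) k
    rw [div_le_iff₀ (by positivity)] at h2
    calc ‖lamC a ξ‖^k ≤ (|ξ| + a)^k := by gcongr
      _ ≤ _ := by linarith
  have h3 : ‖airyE a z ξ‖ ≤ Real.exp ((|ξ| + a) * R + (a^3 - 3 * a * ξ^2)) := by
    unfold airyE
    rw [Complex.norm_exp, Complex.add_re, re_I_lamC_cube]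
    apply Real.exp_le_exp.2
    gcongr
    calc (Complex.I * lamC a ξ * z).re ≤ ‖Complex.I * lamC a ξ * z‖ := Complex.re_le_norm _
      _ = ‖lamC a ξ‖ * ‖z‖ := by simp
      _ ≤ _ := by gcongr
  rw [norm_mul, norm_pow]
  calc _ ≤ (k.factorial * Real.exp (|ξ| + a)) * Real.exp ((|ξ| + a) * R + (a^3 - 3 * a * ξ^2)) := by
        gcongr
    _ = k.factorial * Real.exp ((|ξ| + a) + ((|ξ| + a) * R + (a^3 - 3 * a * ξ^2))) := by
        rw [mul_assoc, ← Real.exp_add]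
    _ ≤ k.factorial * Real.exp ((b * (R+1) + b^3 + (R+1)^2/(4*c)) + (-c * ξ^2)) := by
        refine mul_le_mul_of_nonneg_left (Real.exp_le_exp.2 ?_) (by positivity)
        have e1 : a * (R+1) ≤ b * (R+1) := by gcongr
        have e2 : a^3 ≤ b^3 := by gcongr
        have e3 : c * ξ^2 ≤ a * ξ^2 := by gcongr
        have e4 : |ξ| * (R+1) ≤ c * ξ^2 + (R+1)^2/(4*c) := by
          have : c * ξ^2 + (R+1)^2/(4*c) - |ξ| * (R+1) = (2*c*|ξ| - (R+1))^2/(4*c) := by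
            rw [← sq_abs ξ]; field_simp; ring
          have : 0 ≤ (2*c*|ξ| - (R+1))^2/(4*c) := by positivity
          linarith
        have e5 : 0 ≤ c * ξ^2 := by positivity
        linarith
    _ = _ := by rw [Real.exp_add, mul_assoc]

lemma airyE_cont (a : ℝ) (z : ℂ) (k : ℕ) : Continuous (fun ξ => (lamC a ξ)^k * airyE a z ξ) := by
  unfold airyE lamC
  fun_prop

lemma airyE_int (a : ℝ) (ha : 0 < a) (z : ℂ) (k : ℕ) :
    Integrable (fun ξ => (lamC a ξ)^k * airyE a z ξ) := by
  obtain ⟨C, hC⟩ := airyE_bound a a ‖z‖ k ha (norm_nonneg _)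
  exact ((integrable_exp_neg_mul_sq ha).const_mul C).mono' (airyE_cont a z k).aestronglyMeasurable
    (Eventually.of_forall fun ξ => hC a z ξ le_rfl le_rfl le_rfl)

lemma lamC_hasDerivAt (a ξ : ℝ) : HasDerivAt (fun y => lamC a y) 1 ξ := by
  unfold lamC
  simpa using (Complex.ofRealCLM.hasDerivAt (x := ξ)).add_const (Complex.I * (a:ℂ))

lemma lamC_hasDerivAt' (a ξ : ℝ) : HasDerivAt (fun y => lamC y ξ) Complex.I a := by
  unfold lamC
  simpa using ((Complex.ofRealCLM.hasDerivAt (x := a)).const_mul Complex.I).const_add (ξ:ℂ)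

lemma cexp_comp (z : ℂ) (f : ℝ → ℂ) (d : ℂ) (x : ℝ) (h : HasDerivAt f d x) :
    HasDerivAt (fun y => Complex.exp (Complex.I * f y * z + Complex.I * (f y)^3))
     (d * (Complex.I * z * ((f x)^0 * Complex.exp (Complex.I * f x * z + Complex.I * (f x)^3))
      + 3 * Complex.I * ((f x)^2 * Complex.exp (Complex.I * f x * z + Complex.I * (f x)^3)))) x := by
  convert! (((h.const_mul Complex.I).mul_const z).add ((h.pow 3).const_mul Complex.I)).cexp using 1
  simp
  ring

lemma airyE_parts (a : ℝ) (ha : 0 < a) (z : ℂ) :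
    ∫ ξ : ℝ, (Complex.I * z * ((lamC a ξ)^0 * airyE a z ξ)
      + 3 * Complex.I * ((lamC a ξ)^2 * airyE a z ξ)) = 0 := by
  refine integral_eq_zero_of_hasDerivAt_of_integrable (f := fun ξ => airyE a z ξ) ?_ ?_ ?_
  · intro ξ
    simpa [airyE] using cexp_comp z (fun y => lamC a y) 1 ξ (lamC_hasDerivAt a ξ)
  · exact ((airyE_int a ha z 0).const_mul _).add ((airyE_int a ha z 2).const_mul _)
  · simpa using airyE_int a ha z 0

lemma airyE_two (a : ℝ) (ha : 0 < a) (z : ℂ) :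
    ∫ ξ : ℝ, (lamC a ξ)^2 * airyE a z ξ = -(z/3) * ∫ ξ : ℝ, (lamC a ξ)^0 * airyE a z ξ := by
  have h := airyE_parts a ha z
  rw [integral_add ((airyE_int a ha z 0).const_mul _) ((airyE_int a ha z 2).const_mul _),
    integral_const_mul, integral_const_mul] at h
  have h2 : Complex.I * (z * (∫ ξ : ℝ, (lamC a ξ)^0 * airyE a z ξ)
    + 3 * ∫ ξ : ℝ, (lamC a ξ)^2 * airyE a z ξ) = 0 := by linear_combination h
  have h3 := (mul_eq_zero.1 h2).resolve_left Complex.I_ne_zero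
  linear_combination h3 / 3

lemma airyE_shift_deriv (a : ℝ) (ha : 0 < a) (z : ℂ) :
    HasDerivAt (fun b => ∫ ξ : ℝ, airyE b z ξ) 0 a := by
  obtain ⟨C0, hC0⟩ := airyE_bound (a/2) (2*a) ‖z‖ 0 (by positivity) (norm_nonneg _)
  obtain ⟨C2, hC2⟩ := airyE_bound (a/2) (2*a) ‖z‖ 2 (by positivity) (norm_nonneg _)
  have key := hasDerivAt_integral_of_dominated_loc_of_deriv_le (μ := volume) (x₀ := a)
    (s := Icc (a/2) (2*a)) (F := fun b ξ => airyE b z ξ)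
    (F' := fun b ξ => Complex.I * (Complex.I * z * ((lamC b ξ)^0 * airyE b z ξ)
      + 3 * Complex.I * ((lamC b ξ)^2 * airyE b z ξ)))
    (bound := fun ξ => (‖z‖ * C0 + 3 * C2) * Real.exp (-(a/2) * ξ^2))
    (Icc_mem_nhds (by linarith) (by linarith))
    (Eventually.of_forall fun b => by
      simpa using (airyE_cont b z 0).aestronglyMeasurable)
    (by simpa using airyE_int a ha z 0)
    ((((airyE_int a ha z 0).const_mul _).add
      ((airyE_int a ha z 2).const_mul _)).const_mul _).aestronglyMeasurable
    (Eventually.of_forall fun ξ b hb => ?_)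
    ((integrable_exp_neg_mul_sq (by positivity)).const_mul _)
    (Eventually.of_forall fun ξ b hb => ?_)
  · have := key.2
    rwa [integral_const_mul, airyE_parts a ha z, mul_zero] at this
  · have h0 := hC0 b z ξ hb.1 hb.2 le_rfl
    have h2 := hC2 b z ξ hb.1 hb.2 le_rfl
    rw [norm_mul, Complex.norm_I, one_mul]
    refine (norm_add_le _ _).trans ?_
    rw [norm_mul, norm_mul (3 * Complex.I)]
    simp only [norm_mul Complex.I z, norm_mul 3 Complex.I, Complex.norm_I, one_mul, mul_one,
      Complex.norm_ofNat]
    have := mul_le_mul_of_nonneg_left h0 (norm_nonneg z)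
    linarith
  · simpa [airyE] using cexp_comp z (fun y => lamC y ξ) Complex.I b (lamC_hasDerivAt' b ξ)

lemma airyE_shift (a : ℝ) (ha : 0 < a) (z : ℂ) :
    ∫ ξ : ℝ, (lamC a ξ)^0 * airyE a z ξ = airyG 0 z := by
  simp only [airyG, pow_zero, one_mul]
  exact isOpen_Ioi.is_const_of_deriv_eq_zero (𝕜 := ℝ) (s := Ioi 0)
    (f := fun b => ∫ ξ : ℝ, airyE b z ξ)
    isPreconnected_Ioi
    (fun b hb => (airyE_shift_deriv b hb z).differentiableAt.differentiableWithinAt)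
    (fun b hb => (airyE_shift_deriv b hb z).deriv) ha (by simp : (1:ℝ) ∈ Ioi 0)

lemma airyG_deriv (k : ℕ) (z : ℂ) : HasDerivAt (airyG k) (Complex.I * airyG (k+1) z) z := by
  obtain ⟨C, hC⟩ := airyE_bound 1 1 (‖z‖+1) (k+1) one_pos (by positivity)
  have key := hasDerivAt_integral_of_dominated_loc_of_deriv_le (μ := volume) (x₀ := z)
    (s := Metric.ball z 1) (F := fun w ξ => (lamC 1 ξ)^k * airyE 1 w ξ)
    (F' := fun w ξ => Complex.I * ((lamC 1 ξ)^(k+1) * airyE 1 w ξ))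
    (bound := fun ξ => C * Real.exp (-1 * ξ^2))
    (Metric.ball_mem_nhds _ one_pos)
    (Eventually.of_forall fun b => (airyE_cont 1 b k).aestronglyMeasurable)
    (airyE_int 1 one_pos z k)
    ((airyE_int 1 one_pos z (k+1)).const_mul _).aestronglyMeasurable
    (Eventually.of_forall fun ξ w hw => ?_)
    ((integrable_exp_neg_mul_sq (by positivity)).const_mul _)
    (Eventually.of_forall fun ξ w hw => ?_)
  · have := key.2
    rwa [integral_const_mul] at this
  · rw [norm_mul, Complex.norm_I, one_mul]
    refine hC 1 w ξ le_rfl le_rfl ?_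
    have h1 : ‖w - z‖ < 1 := by simpa [dist_eq_norm] using hw
    have h2 := norm_add_le (w - z) z
    rw [sub_add_cancel] at h2
    linarith
  · unfold airyE
    convert! ((((hasDerivAt_id w).const_mul (Complex.I * lamC 1 ξ)).add_const
      (Complex.I * (lamC 1 ξ)^3)).cexp.const_mul ((lamC 1 ξ)^k)) using 1
    simp
    ring

lemma airyG_two (z : ℂ) : airyG 2 z = -(z/3) * airyG 0 z := airyE_two 1 one_pos z

lemma lamC_scale (ε s η : ℝ) (hs : s ≠ 0) : lamC ε (s * η) = s * lamC (ε / s) η := by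
  have : (s:ℂ) ≠ 0 := by exact_mod_cast hs
  unfold lamC
  push_cast
  field_simp

lemma kdv_scale (ε x t s η : ℝ) (hs : 0 < s) (hst : s^3 * t = 1) :
    Complex.exp (Complex.I * lamC ε (s*η) * (x:ℂ) + Complex.I * (lamC ε (s*η))^3 * (t:ℂ))
      * (lamC ε (s*η))^2 =
    (s:ℂ)^2 * ((lamC (ε/s) η)^2 * airyE (ε/s) ((x * s : ℝ) : ℂ) η) := by
  have h : (s:ℂ)^3 * t = 1 := by exact_mod_cast hst
  rw [lamC_scale ε s η hs.ne']
  unfold airyE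
  have : Complex.I * (s * lamC (ε / s) η) * (x:ℂ) + Complex.I * (s * lamC (ε / s) η)^3 * (t:ℂ)
      = Complex.I * lamC (ε / s) η * ((x * s : ℝ) : ℂ) + Complex.I * (lamC (ε / s) η)^3 := by
    push_cast
    linear_combination (Complex.I * (lamC (ε / s) η)^3) * h
  rw [this]
  ring

lemma kdv_int (ε x t s : ℝ) (hε : 0 < ε) (hs : 0 < s) (hst : s^3 * t = 1) :
    Integrable (fun ξ : ℝ =>
      Complex.exp (Complex.I * lamC ε ξ * (x:ℂ) + Complex.I * (lamC ε ξ)^3 * (t:ℂ))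
        * (lamC ε ξ)^2) := by
  rw [← integrable_comp_mul_left_iff _ hs.ne']
  simp only [kdv_scale ε x t s _ hs hst]
  exact (airyE_int _ (by positivity) _ 2).const_mul _

lemma kdv_formula (ε x t s : ℝ) (hε : 0 < ε) (hs : 0 < s) (hst : s^3 * t = 1) :
    kdvUeps ε x t = (3 / (2 * (Real.pi : ℂ))) * x * (s:ℂ)^4 * airyG 0 ((x * s : ℝ) : ℂ) := by
  have h := Measure.integral_comp_mul_left (fun ξ : ℝ =>
      Complex.exp (Complex.I * lamC ε ξ * (x:ℂ) + Complex.I * (lamC ε ξ)^3 * (t:ℂ))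
        * (lamC ε ξ)^2) s
  simp only [kdv_scale ε x t s _ hs hst] at h
  rw [integral_const_mul, airyE_two _ (by positivity), airyE_shift _ (by positivity),
    abs_of_pos (inv_pos.2 hs), Complex.real_smul] at h
  have hs' : (s:ℂ) ≠ 0 := by exact_mod_cast hs.ne'
  have h2 : (∫ ξ : ℝ, Complex.exp (Complex.I * lamC ε ξ * (x:ℂ) + Complex.I * (lamC ε ξ)^3 * (t:ℂ))
        * (lamC ε ξ)^2) = (s:ℂ)^3 * (-(((x * s : ℝ) : ℂ)/3) * airyG 0 ((x * s : ℝ) : ℂ)) := by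
    generalize (∫ ξ : ℝ, Complex.exp (Complex.I * lamC ε ξ * (x:ℂ)
      + Complex.I * (lamC ε ξ)^3 * (t:ℂ)) * (lamC ε ξ)^2) = J at h ⊢
    push_cast at h ⊢
    field_simp at h ⊢
    linear_combination -h
  unfold kdvUeps
  rw [h2]
  push_cast
  ring

noncomputable def sc (t : ℝ) : ℝ := t ^ (-(1/3) : ℝ)

lemma sc_pos (t : ℝ) (ht : 0 < t) : 0 < sc t := Real.rpow_pos_of_pos ht _

lemma sc_cube (t : ℝ) (ht : 0 < t) : (sc t)^3 * t = 1 := by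
  unfold sc
  rw [← Real.rpow_natCast, ← Real.rpow_mul ht.le]
  norm_num
  rw [Real.rpow_neg_one, inv_mul_cancel₀ ht.ne']

lemma sc_deriv (t : ℝ) (ht : 0 < t) : HasDerivAt sc (-(1/3) * (sc t)^4) t := by
  have h := Real.hasDerivAt_rpow_const (x := t) (p := (-(1/3) : ℝ)) (Or.inl ht.ne')
  convert! h using 2
  unfold sc
  rw [← Real.rpow_natCast, ← Real.rpow_mul ht.le]
  norm_num

lemma kdv_eq (ε x t : ℝ) (hε : 0 < ε) (ht : 0 < t) :
    kdvUeps ε x t = (3 / (2 * (Real.pi : ℂ))) * x * (sc t:ℂ)^4 * airyG 0 ((x * sc t : ℝ) : ℂ) :=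
  kdv_formula ε x t (sc t) hε (sc_pos t ht) (sc_cube t ht)

lemma airyG_contDiff : ContDiff ℝ (⊤:ℕ∞) (airyG 0) := by
  have : Differentiable ℂ (airyG 0) := fun z => (airyG_deriv 0 z).differentiableAt
  exact (this.contDiff (n := (⊤:ℕ∞))).restrict_scalars ℝ

lemma kdv_smooth (ε : ℝ) (hε : 0 < ε) :
    ContDiffOn ℝ (⊤:ℕ∞) (fun p : ℝ × ℝ => kdvUeps ε p.1 p.2) (Ioi (0:ℝ) ×ˢ Ioi (0:ℝ)) := by
  have hsc : ContDiffOn ℝ (⊤:ℕ∞) (fun p : ℝ × ℝ => sc p.2) (Ioi (0:ℝ) ×ˢ Ioi (0:ℝ)) := by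
    unfold sc
    exact contDiff_snd.contDiffOn.rpow_const_of_ne (fun p hp => (ne_of_gt hp.2))
  have ho : ContDiff ℝ (⊤:ℕ∞) (fun x : ℝ => (x:ℂ)) := Complex.ofRealCLM.contDiff
  have hx : ContDiffOn ℝ (⊤:ℕ∞) (fun p : ℝ × ℝ => p.1) (Ioi (0:ℝ) ×ˢ Ioi (0:ℝ)) :=
    contDiff_fst.contDiffOn
  refine ContDiffOn.congr (f := fun p : ℝ × ℝ => (3 / (2 * (Real.pi : ℂ))) * p.1 *
    (sc p.2:ℂ)^4 * airyG 0 ((p.1 * sc p.2 : ℝ) : ℂ)) ?_ (fun p hp => kdv_eq ε _ _ hε hp.2)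
  exact ((contDiffOn_const.mul (ho.comp_contDiffOn hx)).mul ((ho.comp_contDiffOn hsc).pow 4)).mul
    (airyG_contDiff.comp_contDiffOn (ho.comp_contDiffOn (hx.mul hsc)))

lemma ofReal_hasDerivAt (f : ℝ → ℝ) (d x : ℝ) (h : HasDerivAt f d x) :
    HasDerivAt (fun y => (f y : ℂ)) (d:ℂ) x := h.ofReal_comp

lemma airyG_comp (k : ℕ) (f : ℝ → ℝ) (d x : ℝ) (h : HasDerivAt f d x) :
    HasDerivAt (fun y => airyG k ((f y : ℝ) : ℂ)) (Complex.I * airyG (k+1) (f x : ℝ) * d) x :=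
  HasDerivAt.comp (h₂ := airyG k) x (airyG_deriv k (f x : ℝ)) h.ofReal_comp

lemma kdv_dt (ε x t : ℝ) (hε : 0 < ε) (ht : 0 < t) :
    deriv (fun τ => kdvUeps ε x τ) t = (3 / (2 * (Real.pi : ℂ))) * x *
     (-(4/3) * (sc t:ℂ)^7 * airyG 0 ((x * sc t : ℝ) : ℂ)
      - (1/3) * (sc t:ℂ)^8 * x * (Complex.I * airyG 1 ((x * sc t : ℝ) : ℂ))) := by
  have he : (fun τ => kdvUeps ε x τ) =ᶠ[𝓝 t] (fun τ => (3 / (2 * (Real.pi : ℂ))) * x *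
      ((sc τ:ℂ)^4 * airyG 0 ((x * sc τ : ℝ) : ℂ))) := by
    filter_upwards [Ioi_mem_nhds ht] with τ hτ
    rw [kdv_eq ε x τ hε hτ, mul_assoc _ (_^4)]
  rw [he.deriv_eq]
  have hs := sc_deriv t ht
  have h := (((hs.ofReal_comp).pow 4).mul (airyG_comp 0 _ _ t (hs.const_mul x))).const_mul
    ((3 / (2 * (Real.pi : ℂ))) * x)
  refine h.deriv.trans ?_
  simp only [zero_add, Pi.pow_apply]
  push_cast
  ring

lemma kdv_dxxx (ε x t : ℝ) (hε : 0 < ε) (ht : 0 < t) :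
    iteratedDeriv 3 (fun y => kdvUeps ε y t) x = -((3 / (2 * (Real.pi : ℂ))) * x *
     (-(4/3) * (sc t:ℂ)^7 * airyG 0 ((x * sc t : ℝ) : ℂ)
      - (1/3) * (sc t:ℂ)^8 * x * (Complex.I * airyG 1 ((x * sc t : ℝ) : ℂ)))) := by
  set s := sc t with hs
  set K := (3 / (2 * (Real.pi : ℂ))) with hK
  have he : (fun y => kdvUeps ε y t) = (fun y : ℝ => K * (s:ℂ)^4 *
      ((y:ℂ) * airyG 0 ((y * s : ℝ) : ℂ))) := by
    funext y
    rw [kdv_eq ε y t hε ht]; ring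
  have hlin : ∀ y : ℝ, HasDerivAt (fun y : ℝ => y * s) s y := fun y => by
    simpa using (hasDerivAt_id y).mul_const s
  have hid : ∀ y : ℝ, HasDerivAt (fun y : ℝ => (y:ℂ)) 1 y := fun y => by
    simpa using (hasDerivAt_id y).ofReal_comp
  have d1 : deriv (fun y : ℝ => K * (s:ℂ)^4 * ((y:ℂ) * airyG 0 ((y * s : ℝ) : ℂ))) =
      fun y : ℝ => K * (s:ℂ)^4 * (airyG 0 ((y * s : ℝ) : ℂ) +
        (y:ℂ) * s * Complex.I * airyG 1 ((y * s : ℝ) : ℂ)) := by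
    funext y
    refine (((hid y).mul (airyG_comp 0 _ _ y (hlin y))).const_mul _).deriv.trans ?_
    simp only [zero_add]
    ring
  have d2 : deriv (fun y : ℝ => K * (s:ℂ)^4 * (airyG 0 ((y * s : ℝ) : ℂ) +
        (y:ℂ) * s * Complex.I * airyG 1 ((y * s : ℝ) : ℂ))) =
      fun y : ℝ => K * (s:ℂ)^4 * (2 * s * Complex.I * airyG 1 ((y * s : ℝ) : ℂ) +
        (1/3) * (s:ℂ)^3 * ((y:ℂ)^2 * airyG 0 ((y * s : ℝ) : ℂ))) := by
    funext y
    refine (((airyG_comp 0 _ _ y (hlin y)).add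
      ((((hid y).mul_const (s:ℂ)).mul_const Complex.I).mul
        (airyG_comp 1 _ _ y (hlin y)))).const_mul _).deriv.trans ?_
    simp only [zero_add, Nat.reduceAdd, airyG_two]
    push_cast
    ring_nf
    simp only [Complex.I_sq]
    ring
  have d3 : deriv (fun y : ℝ => K * (s:ℂ)^4 * (2 * s * Complex.I * airyG 1 ((y * s : ℝ) : ℂ) +
        (1/3) * (s:ℂ)^3 * ((y:ℂ)^2 * airyG 0 ((y * s : ℝ) : ℂ)))) x =
      K * (s:ℂ)^4 * ((4/3) * (s:ℂ)^3 * x * airyG 0 ((x * s : ℝ) : ℂ) +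
        (1/3) * (s:ℂ)^4 * ((x:ℂ)^2 * (Complex.I * airyG 1 ((x * s : ℝ) : ℂ)))) := by
    refine ((((airyG_comp 1 _ _ x (hlin x)).const_mul _).add
      ((((hid x).pow 2).mul
        (airyG_comp 0 _ _ x (hlin x))).const_mul _)).const_mul _).deriv.trans ?_
    simp only [zero_add, Nat.reduceAdd, airyG_two, Pi.pow_apply]
    push_cast
    ring_nf
    simp only [Complex.I_sq]
    ring
  rw [he, iteratedDeriv_succ, iteratedDeriv_succ, iteratedDeriv_one, d1, d2, d3]
  ring

lemma airyG_bound : ∃ C : ℝ, ∀ y : ℝ, ‖airyG 0 (y:ℂ)‖ ≤ C * Real.exp (-y) := by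
  refine ⟨∫ ξ : ℝ, ‖(lamC 1 ξ)^0 * airyE 1 0 ξ‖, fun y => ?_⟩
  unfold airyG
  refine (norm_integral_le_integral_norm _).trans (le_of_eq ?_)
  rw [← integral_mul_const]
  congr 1
  funext ξ
  simp only [pow_zero, one_mul, airyE, Complex.norm_exp, ← Real.exp_add]
  congr 1
  simp [lamC]
  ring

lemma kdv_t0 (ε : ℝ) (hε : 0 < ε) (x : ℝ) (hx : 0 < x) :
    Tendsto (fun t => kdvUeps ε x t) (𝓝[>] (0:ℝ)) (𝓝 0) := by
  obtain ⟨C, hC⟩ := airyG_bound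
  have hs : Tendsto sc (𝓝[>] (0:ℝ)) atTop := tendsto_rpow_neg_nhdsGT_zero (by norm_num)
  have h1 : Tendsto (fun t => x * sc t) (𝓝[>] (0:ℝ)) atTop := hs.const_mul_atTop hx
  have h2 := ((Real.tendsto_pow_mul_exp_neg_atTop_nhds_zero 4).comp h1).const_mul
    (‖(3 / (2 * (Real.pi : ℂ)))‖ * x⁻¹^3 * C)
  rw [mul_zero] at h2
  refine squeeze_zero_norm' ?_ h2
  filter_upwards [self_mem_nhdsWithin] with t ht
  have hp := sc_pos t ht
  rw [kdv_eq ε x t hε ht, norm_mul, norm_mul, norm_mul, norm_pow, Complex.norm_real,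
    Complex.norm_real, Real.norm_of_nonneg hx.le, Real.norm_of_nonneg hp.le]
  calc _ ≤ ‖(3 / (2 * (Real.pi : ℂ)))‖ * x * sc t^4 * (C * Real.exp (-(x * sc t))) := by
        gcongr
        exact hC _
    _ = _ := by
        simp only [Function.comp]
        field_simp

lemma kdv_x0 (ε : ℝ) (hε : 0 < ε) (t : ℝ) (ht : 0 < t) :
    Tendsto (fun x => kdvUeps ε x t) (𝓝[>] (0:ℝ)) (𝓝 0) := by
  have hc : Continuous (fun x : ℝ => kdvUeps ε x t) := by
    simp only [kdv_eq ε _ t hε ht]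
    have := airyG_contDiff.continuous
    fun_prop
  have h := (hc.tendsto 0).mono_left (nhdsWithin_le_nhds (s := Ioi 0))
  have h0 : kdvUeps ε 0 t = 0 := by rw [kdv_eq ε _ t hε ht]; simp
  rwa [h0] at h

lemma airyG_ne : ¬ ∀ y : ℝ, 0 < y → airyG 0 (y:ℂ) = 0 := by
  intro h
  have hdiff : Differentiable ℂ (airyG 0) := fun z => (airyG_deriv 0 z).differentiableAt
  have han : AnalyticOnNhd ℂ (airyG 0) univ :=
    hdiff.differentiableOn.analyticOnNhd isOpen_univ
  have hz : airyG 0 = fun _ => 0 := by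
    refine han.eq_of_frequently_eq (z₀ := 1) analyticOnNhd_const ?_
    have ht : Tendsto (fun n : ℝ => ((1 + n : ℝ) : ℂ)) (𝓝[>] 0) (𝓝[≠] 1) := by
      refine tendsto_nhdsWithin_iff.2 ⟨?_, ?_⟩
      · have : Continuous (fun n : ℝ => ((1 + n : ℝ) : ℂ)) := by fun_prop
        have h2 := (this.tendsto 0).mono_left (nhdsWithin_le_nhds (s := Ioi 0))
        simpa using h2
      · filter_upwards [self_mem_nhdsWithin] with n hn
        have : n ≠ 0 := ne_of_gt hn
        simpa using this
    refine ht.frequently (Eventually.frequently ?_)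
    filter_upwards [self_mem_nhdsWithin] with n hn
    have hn' : (0:ℝ) < n := hn
    exact h _ (by positivity)
  have hintE : Integrable (fun ξ => airyE 1 0 ξ) := by simpa using airyE_int 1 one_pos 0 0
  have hcont : Continuous (fun ξ => airyE 1 0 ξ) := by simpa using airyE_cont 1 0 0
  have hF : FourierTransform.fourier (fun ξ => airyE 1 0 ξ) = (fun _ : ℝ => (0:ℂ)) := by
    funext w
    rw [Real.fourier_real_eq_integral_exp_smul]
    have h1 : airyG 0 ((-2 * Real.pi * w : ℝ) : ℂ) = 0 := by rw [hz]
    unfold airyG at h1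
    have h2 : ∀ ξ : ℝ, Complex.exp (((-2 * Real.pi * ξ * w : ℝ) : ℂ) * Complex.I) • airyE 1 0 ξ
        = Complex.exp ((-2 * Real.pi * w : ℝ) : ℂ) *
          ((lamC 1 ξ)^0 * airyE 1 ((-2 * Real.pi * w : ℝ) : ℂ) ξ) := by
      intro ξ
      simp only [airyE, smul_eq_mul, pow_zero, one_mul, ← Complex.exp_add]
      congr 1
      simp only [lamC]
      push_cast
      ring_nf
      simp only [Complex.I_sq]
      ring
    simp only [h2]
    rw [integral_const_mul, h1, mul_zero]
  have hinv := hcont.fourierInv_fourier_eq hintE (by rw [hF]; exact integrable_zero _ _ _)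
  have h0 := congrFun hinv 0
  rw [hF] at h0
  have h1 : airyE 1 0 0 = 0 := by
    rw [← h0, Real.fourierInv_eq']
    simp
  exact Complex.exp_ne_zero _ h1

lemma kdv_ne (ε : ℝ) (hε : 0 < ε) : ¬ ∀ x > (0:ℝ), ∀ t > (0:ℝ), kdvUeps ε x t = 0 := by
  intro h
  apply airyG_ne
  intro y hy
  have h1 := h y hy 1 one_pos
  rw [kdv_formula ε y 1 1 hε one_pos (by norm_num)] at h1
  have hy' : (y:ℂ) ≠ 0 := by exact_mod_cast hy.ne'
  have hpi : (Real.pi:ℂ) ≠ 0 := by exact_mod_cast Real.pi_ne_zero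
  simpa [hy', hpi] using h1

lemma kdv_solves (ε : ℝ) (hε : 0 < ε) : SolvesHomLKdV (fun x t => kdvUeps ε x t) := by
  refine ⟨kdv_smooth ε hε, fun x _ t ht => ?_, fun t ht => kdv_x0 ε hε t ht,
    fun x hx => kdv_t0 ε hε x hx⟩
  rw [kdv_dt ε x t hε ht, kdv_dxxx ε x t hε ht, neg_neg]

lemma zero_solves : SolvesHomLKdV (fun _ _ => 0) := by
  refine ⟨contDiffOn_const, fun x _ t _ => ?_, fun _ _ => tendsto_const_nhds,
    fun _ _ => tendsto_const_nhds⟩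
  simp

theorem stmt5 (ε : ℝ) (hε : 0 < ε) :
    (∀ x > (0:ℝ), ∀ t > (0:ℝ), Integrable (fun ξ : ℝ =>
      Complex.exp (Complex.I * lamC ε ξ * (x:ℂ) + Complex.I * (lamC ε ξ)^3 * (t:ℂ))
        * (lamC ε ξ)^2)) ∧
    SolvesHomLKdV (fun x t => kdvUeps ε x t) ∧
    (¬ ∀ x > (0:ℝ), ∀ t > (0:ℝ), kdvUeps ε x t = 0) ∧
    (∃ u₁ u₂ : ℝ → ℝ → ℂ, SolvesHomLKdV u₁ ∧ SolvesHomLKdV u₂ ∧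
      ∃ x > (0:ℝ), ∃ t > (0:ℝ), u₁ x t ≠ u₂ x t) := by
  refine ⟨fun x _ t ht => kdv_int ε x t (sc t) hε (sc_pos t ht) (sc_cube t ht),
    kdv_solves ε hε, kdv_ne ε hε, fun x t => kdvUeps ε x t, fun _ _ => 0,
    kdv_solves ε hε, zero_solves, ?_⟩
  have h := kdv_ne ε hε
  push Not at h
  exact h
end

section
/- Fix ε > 0. For every integer n ≥ 1, the function u_n(x,t) := −(9/(2π)) ∫_{−∞}^{∞} ( i(ξ+iε)³ )^{n−1} e^{i(ξ+iε)x + i(ξ+iε)³ t} (ξ+iε)² dξ, defined for (x,t) ∈ Q (the integral converges absolutely for t > 0), is smooth on Q, satisfies u_t = −u_{xxx} at every point of Q, and satisfies lim_{x→0⁺} u_n(x,t) = 0 for every t > 0 and lim_{t→0⁺} u_n(x,t) = 0 for every x > 0. -/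
open MeasureTheory Filter Set Topology

/-- `u_n(x,t) = −(9/(2π)) ∫_{Im λ = ε} (iλ³)^{n−1} e^{iλx + iλ³t} λ² dλ`. -/
noncomputable def kdvUneps (ε : ℝ) (n : ℕ) (x t : ℝ) : ℂ :=
  -(9 / (2 * (Real.pi : ℂ))) *
    ∫ ξ : ℝ, (Complex.I * (lamC ε ξ)^3)^(n-1) *
      Complex.exp (Complex.I * lamC ε ξ * (x:ℂ) + Complex.I * (lamC ε ξ)^3 * (t:ℂ))
      * (lamC ε ξ)^2

/-- The basic integrand. -/
noncomputable def kE (m : ℕ) (a x t ξ : ℝ) : ℂ :=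
  (lamC a ξ)^m * Complex.exp (Complex.I * lamC a ξ * (x:ℂ) + Complex.I * (lamC a ξ)^3 * (t:ℂ))

/-- The basic integral. -/
noncomputable def kI (m : ℕ) (a x t : ℝ) : ℂ := ∫ ξ : ℝ, kE m a x t ξ

/-- The dominating function. -/
noncomputable def kB (m : ℕ) (c K b ξ : ℝ) : ℝ := (|ξ| + c)^m * (K * Real.exp (-b * ξ^2))

lemma kB_int (m : ℕ) (c K b : ℝ) (hc : 0 ≤ c) (hb : 0 < b) : Integrable (kB m c K b) := by
  have h1 : Integrable (fun ξ : ℝ => |ξ|^m * Real.exp (-b * ξ^2)) := by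
    have h := (integrable_rpow_mul_exp_neg_mul_sq hb (s := (m:ℝ))
      (by have : (0:ℝ) ≤ m := Nat.cast_nonneg m
          linarith)).norm
    refine h.congr (Eventually.of_forall fun ξ => ?_)
    simp [Real.rpow_natCast]
  have h2 : Integrable (fun ξ : ℝ => c^m * Real.exp (-b * ξ^2)) :=
    (integrable_exp_neg_mul_sq hb).const_mul _
  have h3 := ((h1.add h2).const_mul (2^(m-1) * |K|))
  refine h3.mono' (by unfold kB; fun_prop) (Eventually.of_forall fun ξ => ?_)
  have h4 := add_pow_le (abs_nonneg ξ) hc m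
  have h5 : 0 ≤ |K| * Real.exp (-b * ξ^2) := by positivity
  have h6 := mul_le_mul_of_nonneg_right h4 h5
  have h7 : ‖kB m c K b ξ‖ = (|ξ| + c)^m * (|K| * Real.exp (-b * ξ^2)) := by
    unfold kB
    have : 0 ≤ |ξ| + c := by positivity
    rw [norm_mul, norm_mul, norm_pow, Real.norm_eq_abs, Real.norm_eq_abs, Real.norm_eq_abs, abs_of_nonneg this,
      abs_of_pos (Real.exp_pos _)]
  rw [h7]
  refine h6.trans (le_of_eq ?_)
  simp only [Pi.add_apply]
  ring

lemma kE_norm_le (m : ℕ) (a x t ξ a1 a2 t1 t2 R : ℝ) (h1 : 0 < a1) (h2 : a1 ≤ a) (h3 : a ≤ a2)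
    (h4 : 0 < t1) (h5 : t1 ≤ t) (h6 : t ≤ t2) (hR : |x| ≤ R) :
    ‖kE m a x t ξ‖ ≤ kB m a2 (Real.exp (a2 * R + a2^3 * t2)) (3 * a1 * t1) ξ := by
  unfold kE kB
  rw [norm_mul, norm_pow, Complex.norm_exp, ← Real.exp_add]
  have hre : (Complex.I * lamC a ξ * (x:ℂ) + Complex.I * (lamC a ξ)^3 * (t:ℂ)).re
      = - a * x + (a^3 - 3 * a * ξ^2) * t := by
    simp only [lamC, pow_succ, pow_zero, one_mul, Complex.add_re, Complex.mul_re, Complex.mul_im,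
      Complex.add_im, Complex.I_re, Complex.I_im, Complex.ofReal_re, Complex.ofReal_im]
    ring
  rw [hre]
  have hn : ‖lamC a ξ‖ ≤ |ξ| + a2 := by
    unfold lamC
    refine (norm_add_le _ _).trans ?_
    simp only [Complex.norm_real, norm_mul, Complex.norm_I, one_mul, Real.norm_eq_abs]
    rw [abs_of_pos (h1.trans_le h2)]
    linarith
  have ha : 0 < a := h1.trans_le h2
  have ht : 0 < t := h4.trans_le h5
  have hn0 : 0 ≤ |ξ| + a2 := (norm_nonneg _).trans hn
  have e1 : -a * x ≤ a2 * R := by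
    have : -x ≤ R := (neg_le_abs x).trans hR
    have hR0 : 0 ≤ R := (abs_nonneg x).trans hR
    nlinarith
  have e2 : a^3 * t ≤ a2^3 * t2 := by
    have : 0 ≤ a2 := by linarith
    gcongr
  have e3 : a1 * t1 ≤ a * t := by gcongr
  have e4 : a1 * t1 * ξ^2 ≤ a * t * ξ^2 := by gcongr
  have e5 : - a * x + (a^3 - 3 * a * ξ^2) * t ≤ a2 * R + a2 ^ 3 * t2 + -(3 * a1 * t1) * ξ ^ 2 := by
    nlinarith
  gcongr

lemma kE_cont (m : ℕ) (a x t : ℝ) : Continuous (kE m a x t) := by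
  unfold kE lamC
  fun_prop

lemma kE_int (m : ℕ) (a x t : ℝ) (ha : 0 < a) (ht : 0 < t) : Integrable (kE m a x t) :=
  (kB_int m a _ (3*a*t) ha.le (by positivity)).mono' (kE_cont m a x t).aestronglyMeasurable
    (Eventually.of_forall fun ξ => kE_norm_le m a x t ξ a a t t |x| ha le_rfl le_rfl ht le_rfl le_rfl le_rfl)

/-- derivative of the integrand, as a linear map -/
noncomputable def kL1 : ℝ × ℝ →L[ℝ] ℂ := Complex.ofRealCLM.comp (ContinuousLinearMap.fst ℝ ℝ ℝ)

/-- derivative of the integrand, as a linear map -/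
noncomputable def kL2 : ℝ × ℝ →L[ℝ] ℂ := Complex.ofRealCLM.comp (ContinuousLinearMap.snd ℝ ℝ ℝ)

lemma kE_fderiv (m : ℕ) (a ξ : ℝ) (p : ℝ × ℝ) :
    HasFDerivAt (fun p : ℝ × ℝ => kE m a p.1 p.2 ξ)
      ((Complex.I * kE (m+1) a p.1 p.2 ξ) • kL1 + (Complex.I * kE (m+3) a p.1 p.2 ξ) • kL2) p := by
  unfold kE
  have h1 : HasFDerivAt (fun p : ℝ × ℝ => (p.1 : ℂ)) kL1 p := kL1.hasFDerivAt
  have h2 : HasFDerivAt (fun p : ℝ × ℝ => (p.2 : ℂ)) kL2 p := kL2.hasFDerivAt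
  have h3 := (((h1.const_mul (Complex.I * lamC a ξ)).add
    (h2.const_mul (Complex.I * (lamC a ξ)^3))).cexp).const_mul ((lamC a ξ)^m)
  refine h3.congr_fderiv ?_
  ext v <;> simp <;> ring

lemma kI_fderiv (m : ℕ) (a : ℝ) (ha : 0 < a) (p : ℝ × ℝ) (hp : 0 < p.2) :
    HasFDerivAt (fun p : ℝ × ℝ => kI m a p.1 p.2)
      ((Complex.I * kI (m+1) a p.1 p.2) • kL1 + (Complex.I * kI (m+3) a p.1 p.2) • kL2) p := by
  have hi : ∀ k, Integrable (fun ξ => Complex.I * kE k a p.1 p.2 ξ) := fun k =>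
    (kE_int k a p.1 p.2 ha hp).const_mul _
  have hs : {q : ℝ × ℝ | |q.1| < |p.1| + 1 ∧ p.2/2 < q.2 ∧ q.2 < 2 * p.2} ∈ 𝓝 p := by
    apply IsOpen.mem_nhds
    · exact (isOpen_lt (f := fun q : ℝ × ℝ => |q.1|) (by fun_prop) continuous_const).inter
        ((isOpen_lt (g := fun q : ℝ × ℝ => q.2) continuous_const (by fun_prop)).inter
        (isOpen_lt (f := fun q : ℝ × ℝ => q.2) (by fun_prop) continuous_const))
    · refine ⟨?_, ?_, ?_⟩ <;> linarith
  set B : ℕ → ℝ → ℝ := fun k => kB k a (Real.exp (a * (|p.1|+1) + a^3 * (2 * p.2))) (3 * a * (p.2/2)) with hB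
  have hBi : ∀ k, Integrable (B k) := fun k => kB_int _ _ _ _ ha.le (by positivity)
  have hm : Continuous (fun ξ => (Complex.I * kE (m+1) a p.1 p.2 ξ) • kL1
        + (Complex.I * kE (m+3) a p.1 p.2 ξ) • kL2) := by
    have c1 := kE_cont (m+1) a p.1 p.2
    have c2 := kE_cont (m+3) a p.1 p.2
    fun_prop
  have key := hasFDerivAt_integral_of_dominated_of_fderiv_le (μ := volume) (𝕜 := ℝ)
    (F := fun (q : ℝ × ℝ) ξ => kE m a q.1 q.2 ξ)
    (F' := fun (q : ℝ × ℝ) ξ => (Complex.I * kE (m+1) a q.1 q.2 ξ) • kL1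
        + (Complex.I * kE (m+3) a q.1 q.2 ξ) • kL2)
    (x₀ := p) (bound := fun ξ => B (m+1) ξ * ‖kL1‖ + B (m+3) ξ * ‖kL2‖) hs
    (Eventually.of_forall fun q => (kE_cont m a q.1 q.2).aestronglyMeasurable)
    (kE_int m a p.1 p.2 ha hp)
    hm.aestronglyMeasurable
    (Eventually.of_forall fun ξ q hq => by
      obtain ⟨q1, q2, q3⟩ := hq
      have hk : ∀ k, ‖kE k a q.1 q.2 ξ‖ ≤ B k ξ := fun k =>
        kE_norm_le k a q.1 q.2 ξ a a (p.2/2) (2*p.2) (|p.1|+1) ha le_rfl le_rfl (by positivity) q2.le q3.le q1.le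
      refine (norm_add_le _ _).trans ?_
      rw [norm_smul, norm_smul, norm_mul, norm_mul, Complex.norm_I, one_mul, one_mul]
      have := hk (m+1)
      have := hk (m+3)
      gcongr)
    (((hBi _).mul_const _).add ((hBi _).mul_const _))
    (Eventually.of_forall fun ξ q _ => kE_fderiv m a ξ q)
  unfold kI
  refine key.congr_fderiv ?_
  rw [integral_add ((hi _).smul_const _) ((hi _).smul_const _), integral_smul_const, integral_smul_const,
    integral_const_mul, integral_const_mul]

lemma kI_contDiff (a : ℝ) (ha : 0 < a) (k : ℕ) : ∀ (m : ℕ) (p : ℝ × ℝ), 0 < p.2 →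
    ContDiffAt ℝ k (fun p : ℝ × ℝ => kI m a p.1 p.2) p := by
  have hop : IsOpen {q : ℝ × ℝ | 0 < q.2} := isOpen_lt (by fun_prop) (by fun_prop)
  induction k with
  | zero =>
    intro m p hp
    rw [Nat.cast_zero, contDiffAt_zero]
    exact ⟨_, hop.mem_nhds hp, fun q hq => (kI_fderiv m a ha q hq).continuousAt.continuousWithinAt⟩
  | succ k ih =>
    intro m p hp
    push_cast
    rw [contDiffAt_succ_iff_hasFDerivAt]
    refine ⟨_, ⟨_, hop.mem_nhds hp, fun q hq => kI_fderiv m a ha q hq⟩, ?_⟩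
    exact ((contDiffAt_const.mul (ih (m+1) p hp)).smul contDiffAt_const).add
      ((contDiffAt_const.mul (ih (m+3) p hp)).smul contDiffAt_const)

lemma kI_derivx (m : ℕ) (a : ℝ) (ha : 0 < a) (x t : ℝ) (ht : 0 < t) :
    HasDerivAt (fun y => kI m a y t) (Complex.I * kI (m+1) a x t) x := by
  have h := (kI_fderiv m a ha (x, t) ht).comp_hasDerivAt (f := fun y : ℝ => (y, t)) x
    ((hasDerivAt_id x).prodMk (hasDerivAt_const x t))
  refine h.congr_deriv ?_
  simp [kL1, kL2]

lemma kI_derivt (m : ℕ) (a : ℝ) (ha : 0 < a) (x t : ℝ) (ht : 0 < t) :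
    HasDerivAt (fun s => kI m a x s) (Complex.I * kI (m+3) a x t) t := by
  have h := (kI_fderiv m a ha (x, t) ht).comp_hasDerivAt (f := fun y : ℝ => (x, y)) t
    ((hasDerivAt_const t x).prodMk (hasDerivAt_id t))
  refine h.congr_deriv ?_
  simp [kL1, kL2]

/-- complex derivative of the integrand -/
noncomputable def kD (m : ℕ) (a x t ξ : ℝ) : ℂ :=
  (m:ℂ) * kE (m-1) a x t ξ + Complex.I * x * kE m a x t ξ + 3 * Complex.I * t * kE (m+2) a x t ξ

lemma kE_deriv_aux (m : ℕ) (x t : ℝ) (z : ℂ) :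
    HasDerivAt (fun z : ℂ => z^m * Complex.exp (Complex.I * z * (x:ℂ) + Complex.I * z^3 * (t:ℂ)))
     ((m:ℂ) * (z^(m-1) * Complex.exp (Complex.I * z * (x:ℂ) + Complex.I * z^3 * (t:ℂ)))
      + Complex.I * x * (z^m * Complex.exp (Complex.I * z * (x:ℂ) + Complex.I * z^3 * (t:ℂ)))
      + 3 * Complex.I * t * (z^(m+2) * Complex.exp (Complex.I * z * (x:ℂ) + Complex.I * z^3 * (t:ℂ)))) z := by
  have h1 := ((((hasDerivAt_id z).const_mul Complex.I).mul_const (x:ℂ)).add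
    (((hasDerivAt_pow 3 z).const_mul Complex.I).mul_const (t:ℂ))).cexp
  have h2 := (hasDerivAt_pow m z).mul h1
  refine h2.congr_deriv ?_
  simp
  ring

lemma kE_deriv_xi (m : ℕ) (a x t ξ : ℝ) : HasDerivAt (kE m a x t) (kD m a x t ξ) ξ := by
  have h1 : HasDerivAt (fun ξ : ℝ => lamC a ξ) 1 ξ := by
    unfold lamC
    exact (Complex.ofRealCLM.hasDerivAt (x := ξ)).add_const _
  have h := (kE_deriv_aux m x t (lamC a ξ)).comp ξ h1
  rw [mul_one] at h
  exact h

lemma kE_deriv_a (m : ℕ) (a x t ξ : ℝ) :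
    HasDerivAt (fun a => kE m a x t ξ) (Complex.I * kD m a x t ξ) a := by
  have h1 : HasDerivAt (fun a : ℝ => lamC a ξ) (Complex.I * 1) a := by
    unfold lamC
    exact ((Complex.ofRealCLM.hasDerivAt (x := a)).const_mul Complex.I).const_add _
  have h := (kE_deriv_aux m x t (lamC a ξ)).comp a h1
  refine h.congr_deriv ?_
  unfold kD kE
  ring

lemma kD_int (m : ℕ) (a x t : ℝ) (ha : 0 < a) (ht : 0 < t) : Integrable (kD m a x t) :=
  (((kE_int _ a x t ha ht).const_mul _).add ((kE_int _ a x t ha ht).const_mul _)).add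
    ((kE_int _ a x t ha ht).const_mul _)

lemma kD_integral (m : ℕ) (a x t : ℝ) (ha : 0 < a) (ht : 0 < t) : ∫ ξ, kD m a x t ξ = 0 :=
  integral_eq_zero_of_hasDerivAt_of_integrable (fun ξ => kE_deriv_xi m a x t ξ)
    (kD_int m a x t ha ht) (kE_int m a x t ha ht)

lemma kI_rec (m : ℕ) (a x t : ℝ) (ha : 0 < a) (ht : 0 < t) :
    (m:ℂ) * kI (m-1) a x t + Complex.I * x * kI m a x t + 3 * Complex.I * t * kI (m+2) a x t = 0 := by
  have h := kD_integral m a x t ha ht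
  unfold kD at h
  have hi : ∀ (c : ℂ) k, Integrable (fun ξ => c * kE k a x t ξ) := fun c k =>
    (kE_int k a x t ha ht).const_mul _
  rw [integral_add (f := fun ξ => (m:ℂ) * kE (m-1) a x t ξ + Complex.I * x * kE m a x t ξ)
    ((hi _ _).add (hi _ _)) (hi _ _), integral_add (hi _ _) (hi _ _),
    integral_const_mul, integral_const_mul, integral_const_mul] at h
  exact h

lemma kI_zero (k : ℕ) (a t : ℝ) (ha : 0 < a) (ht : 0 < t) : kI (3*k+2) a 0 t = 0 := by
  have ht' : (t:ℂ) ≠ 0 := by exact_mod_cast ht.ne'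
  induction k with
  | zero =>
    have h := kI_rec 0 a 0 t ha ht
    simpa [ht'] using h
  | succ k ih =>
    have h := kI_rec (3*(k+1)) a 0 t ha ht
    have e : 3*(k+1) - 1 = 3*k+2 := by omega
    rw [e, ih] at h
    simpa [ht'] using h

lemma kI_deriv_a (m : ℕ) (a x t : ℝ) (ha : 0 < a) (ht : 0 < t) :
    HasDerivAt (fun a => kI m a x t) 0 a := by
  have hs : Ioo (a/2) (2*a) ∈ 𝓝 a := Ioo_mem_nhds (by linarith) (by linarith)
  set B : ℕ → ℝ → ℝ := fun k => kB k (2*a) (Real.exp ((2*a) * |x| + (2*a)^3 * t)) (3 * (a/2) * t) with hB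
  have hBi : ∀ k, Integrable (B k) := fun k => kB_int _ _ _ _ (by positivity) (by positivity)
  have key := hasDerivAt_integral_of_dominated_loc_of_deriv_le (μ := volume) (𝕜 := ℝ)
    (F := fun a ξ => kE m a x t ξ) (F' := fun a ξ => Complex.I * kD m a x t ξ) (x₀ := a)
    (bound := fun ξ => m * B (m-1) ξ + |x| * B m ξ + 3 * t * B (m+2) ξ) hs
    (Eventually.of_forall fun q => (kE_cont m q x t).aestronglyMeasurable)
    (kE_int m a x t ha ht)
    ((kD_int m a x t ha ht).const_mul _).aestronglyMeasurable
    (Eventually.of_forall fun ξ q hq => by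
      have hk : ∀ k, ‖kE k q x t ξ‖ ≤ B k ξ := fun k =>
        kE_norm_le k q x t ξ (a/2) (2*a) t t |x| (by positivity) hq.1.le hq.2.le ht le_rfl le_rfl le_rfl
      rw [norm_mul, Complex.norm_I, one_mul]
      unfold kD
      refine (norm_add_le _ _).trans (add_le_add ((norm_add_le _ _).trans (add_le_add ?_ ?_)) ?_)
      · rw [norm_mul, Complex.norm_natCast]
        exact mul_le_mul_of_nonneg_left (hk _) (by positivity)
      · rw [norm_mul, norm_mul, Complex.norm_I, one_mul, Complex.norm_real, Real.norm_eq_abs]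
        exact mul_le_mul_of_nonneg_left (hk _) (by positivity)
      · rw [norm_mul, norm_mul, norm_mul, Complex.norm_I, mul_one, Complex.norm_real, Real.norm_eq_abs,
          abs_of_pos ht, Complex.norm_ofNat]
        exact mul_le_mul_of_nonneg_left (hk _) (by positivity))
    ((((hBi _).const_mul _).add ((hBi _).const_mul _)).add ((hBi _).const_mul _))
    (Eventually.of_forall fun ξ q _ => kE_deriv_a m q x t ξ)
  refine key.2.congr_deriv ?_
  rw [integral_const_mul, kD_integral m a x t ha ht, mul_zero]

lemma kI_indep (m : ℕ) (a b x t : ℝ) (ha : 0 < a) (hb : 0 < b) (ht : 0 < t) :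
    kI m a x t = kI m b x t := by
  refine isOpen_Ioi.is_const_of_deriv_eq_zero (s := Ioi (0:ℝ)) (f := fun a => kI m a x t)
    isPreconnected_Ioi (fun c hc => (kI_deriv_a m c x t hc ht).differentiableAt.differentiableWithinAt)
    (fun c hc => (kI_deriv_a m c x t hc ht).deriv) ha hb

/-- Scaling: with `a³ t = 1`. -/
lemma kE_scale (m : ℕ) (a x t η : ℝ) (ha : 0 < a) (hat : a^3 * t = 1) :
    kE m a x t (a * η) = (a:ℂ)^m * (Complex.exp (Complex.I * lamC 1 η * ((a*x : ℝ):ℂ)) * kE m 1 0 1 η) := by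
  have h1 : lamC a (a * η) = a * lamC 1 η := by
    unfold lamC
    push_cast
    ring
  have h2 : (a:ℂ)^3 * t = 1 := by exact_mod_cast hat
  unfold kE
  rw [h1, mul_left_comm _ (lamC 1 η ^ m), ← Complex.exp_add, mul_pow, mul_assoc]
  congr 3
  push_cast
  linear_combination (Complex.I * lamC 1 η ^3) * h2

lemma kI_bound (m : ℕ) (a x t : ℝ) (ha : 0 < a) (hat : a^3 * t = 1) :
    ‖kI m a x t‖ ≤ (a^(m+1) * Real.exp (-(x * a))) * ∫ η, ‖kE m 1 0 1 η‖ := by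
  have h := Measure.integral_comp_mul_left (fun ξ => kE m a x t ξ) a
  have h' : kI m a x t = a • ∫ η, kE m a x t (a * η) := by
    rw [h, smul_smul, abs_of_pos (inv_pos.2 ha), mul_inv_cancel₀ ha.ne', one_smul]
    rfl
  rw [h', norm_smul, Real.norm_eq_abs, abs_of_pos ha, pow_succ, mul_comm (a^m) a, mul_assoc, mul_assoc]
  refine mul_le_mul_of_nonneg_left ?_ ha.le
  rw [← mul_assoc, ← integral_const_mul]
  refine norm_integral_le_of_norm_le ((kE_int m 1 0 1 one_pos one_pos).norm.const_mul _)
    (Eventually.of_forall fun η => ?_)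
  rw [kE_scale m a x t η ha hat, norm_mul, norm_mul, norm_pow, Complex.norm_real, Real.norm_eq_abs,
    abs_of_pos ha, Complex.norm_exp, ← mul_assoc]
  refine le_of_eq ?_
  congr 3
  simp [lamC]
  ring

lemma kI_tendsto_t (m : ℕ) (ε x : ℝ) (hε : 0 < ε) (hx : 0 < x) :
    Tendsto (fun t => kI m ε x t) (𝓝[>] (0:ℝ)) (𝓝 0) := by
  have h1 : Tendsto (fun t : ℝ => (t⁻¹)^((1:ℝ)/3)) (𝓝[>] (0:ℝ)) atTop :=
    (tendsto_rpow_atTop (by norm_num)).comp tendsto_inv_nhdsGT_zero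
  have h2 : Tendsto (fun a : ℝ => a^(m+1) * Real.exp (-(x*a))) atTop (𝓝 0) := by
    have := tendsto_rpow_mul_exp_neg_mul_atTop_nhds_zero (m+1:ℕ) x hx
    refine this.congr fun a => ?_
    rw [Real.rpow_natCast, neg_mul]
  have h3 := (h2.comp h1).mul_const (∫ η, ‖kE m 1 0 1 η‖)
  rw [zero_mul] at h3
  refine squeeze_zero_norm' ?_ h3
  filter_upwards [self_mem_nhdsWithin] with t ht
  have ht : 0 < t := ht
  have ha : 0 < (t⁻¹)^((1:ℝ)/3) := by positivity
  rw [kI_indep m ε _ x t hε ha ht]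
  refine kI_bound m _ x t ha ?_
  rw [← Real.rpow_natCast, ← Real.rpow_mul (by positivity)]
  norm_num
  exact inv_mul_cancel₀ ht.ne'

lemma kInt_eq (ε : ℝ) (k : ℕ) (x t ξ : ℝ) :
    (Complex.I * (lamC ε ξ)^3)^k *
        Complex.exp (Complex.I * lamC ε ξ * (x:ℂ) + Complex.I * (lamC ε ξ)^3 * (t:ℂ))
        * (lamC ε ξ)^2 = Complex.I^k * kE (3*k+2) ε x t ξ := by
  unfold kE
  rw [mul_pow, ← pow_mul, pow_add]
  ring

lemma kdv_eq_s7 (ε : ℝ) (n : ℕ) (x t : ℝ) : kdvUneps ε n x t =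
    (-(9 / (2 * (Real.pi : ℂ))) * Complex.I^(n-1)) * kI (3*(n-1)+2) ε x t := by
  unfold kdvUneps kI
  simp_rw [kInt_eq]
  rw [integral_const_mul, mul_assoc]

theorem stmt7 (ε : ℝ) (hε : 0 < ε) (n : ℕ) (hn : 1 ≤ n) :
    (∀ x > (0:ℝ), ∀ t > (0:ℝ), Integrable (fun ξ : ℝ =>
      (Complex.I * (lamC ε ξ)^3)^(n-1) *
        Complex.exp (Complex.I * lamC ε ξ * (x:ℂ) + Complex.I * (lamC ε ξ)^3 * (t:ℂ))
        * (lamC ε ξ)^2)) ∧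
    ContDiffOn ℝ (⊤:ℕ∞) (fun p : ℝ × ℝ => kdvUneps ε n p.1 p.2)
      (Ioi (0:ℝ) ×ˢ Ioi (0:ℝ)) ∧
    (∀ x > (0:ℝ), ∀ t > (0:ℝ),
      deriv (fun s => kdvUneps ε n x s) t
        = -(iteratedDeriv 3 (fun y => kdvUneps ε n y t) x)) ∧
    (∀ t > (0:ℝ), Tendsto (fun x => kdvUneps ε n x t) (𝓝[>] (0:ℝ)) (𝓝 0)) ∧
    (∀ x > (0:ℝ), Tendsto (fun t => kdvUneps ε n x t) (𝓝[>] (0:ℝ)) (𝓝 0)) := by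

  refine ⟨fun x _ t ht => ?_, ?_, fun x _ t ht => ?_, fun t ht => ?_, fun x hx => ?_⟩
  · simp_rw [kInt_eq]
    exact (kE_int _ ε x t hε ht).const_mul _
  · simp_rw [kdv_eq_s7]
    refine fun p hp => ContDiffAt.contDiffWithinAt ?_
    refine contDiffAt_const.mul ?_
    rw [contDiffAt_infty]
    exact fun k => kI_contDiff ε hε k _ p hp.2
  · simp_rw [kdv_eq_s7]
    generalize 3 * (n-1) + 2 = m
    generalize -(9 / (2 * (Real.pi : ℂ))) * Complex.I^(n-1) = c
    have hd : ∀ (c : ℂ) (m : ℕ), deriv (fun y => c * kI m ε y t)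
        = fun y => (c * Complex.I) * kI (m+1) ε y t := fun c m => by
      funext y
      rw [((kI_derivx m ε hε y t ht).const_mul c).deriv, mul_assoc]
    rw [((kI_derivt m ε hε x t ht).const_mul c).deriv, iteratedDeriv_succ', iteratedDeriv_succ',
      iteratedDeriv_succ', iteratedDeriv_zero, hd, hd, hd]
    linear_combination (c * Complex.I * kI (m+3) ε x t) * Complex.I_sq
  · simp_rw [kdv_eq_s7]
    have h := ((kI_derivx (3*(n-1)+2) ε hε 0 t ht).continuousAt.tendsto.mono_left
      (nhdsWithin_le_nhds (s := Ioi 0))).const_mul (-(9 / (2 * (Real.pi : ℂ))) * Complex.I^(n-1))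
    rwa [kI_zero _ _ _ hε ht, mul_zero] at h
  · simp_rw [kdv_eq_s7]
    have h := (kI_tendsto_t (3*(n-1)+2) ε x hε hx).const_mul
      (-(9 / (2 * (Real.pi : ℂ))) * Complex.I^(n-1))
    rwa [mul_zero] at h
end

section
/- Let g₀ ∈ C^∞([0,∞)) be complex-valued, let ω(λ) := −iλ³, let Γ be the contour consisting of the ray {s e^{2πi/3} : s ≥ 0} traversed from infinity to 0 followed by the ray {s e^{iπ/3} : s ≥ 0} traversed from 0 to infinity, and set g̃₀(ω(λ),t) := ∫₀^t e^{ω(λ)τ} g₀(τ) dτ. Define I_g(x,t) := ∫_Γ e^{iλx − ω(λ)t} 3λ² g̃₀(ω(λ),t) dλ for (x,t) ∈ Q. Then I_g is smooth on Q, and for all nonnegative integers k, m, ℓ and every T₀ > 0, x^ℓ · ∂^{k+m} I_g/∂x^k ∂t^m (x,t) → 0 as x → +∞, uniformly for 0 < t ≤ T₀. -/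
open MeasureTheory Filter Set Topology

/-- The dispersion relation `ω(λ) = −iλ³` of the linearized KdV equation. -/
noncomputable def omegaKdV (l : ℂ) : ℂ := -Complex.I * l^3

/-- `g̃₀(ω(λ),t) = ∫₀^t e^{ω(λ)τ} g₀(τ) dτ`. -/
noncomputable def gTildeKdV (g₀ : ℝ → ℂ) (l : ℂ) (t : ℝ) : ℂ :=
  ∫ τ in (0:ℝ)..t, Complex.exp (omegaKdV l * (τ:ℂ)) * g₀ τ

/-- The integrand `e^{iλx − ω(λ)t} 3λ² g̃₀(ω(λ),t)`. -/
noncomputable def FGammaKdV (g₀ : ℝ → ℂ) (x t : ℝ) (l : ℂ) : ℂ :=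
  Complex.exp (Complex.I * l * (x:ℂ) - omegaKdV l * (t:ℂ)) * (3 * l^2) * gTildeKdV g₀ l t

/-- `I_g(x,t) = ∫_Γ e^{iλx − ω(λ)t} 3λ² g̃₀(ω(λ),t) dλ`, where `Γ` consists of the ray
`{s e^{2πi/3} : s ≥ 0}` from infinity to `0` followed by the ray `{s e^{iπ/3} : s ≥ 0}`
from `0` to infinity:
`∫_Γ F dλ = ∫₀^∞ F(s e^{iπ/3}) e^{iπ/3} ds − ∫₀^∞ F(s e^{2iπ/3}) e^{2iπ/3} ds`. -/
noncomputable def IgKdV (g₀ : ℝ → ℂ) (x t : ℝ) : ℂ :=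
  (∫ s in Ioi (0:ℝ),
      FGammaKdV g₀ x t ((s:ℂ) * Complex.exp (Complex.I * (Real.pi:ℂ) / 3))
        * Complex.exp (Complex.I * (Real.pi:ℂ) / 3))
  - (∫ s in Ioi (0:ℝ),
      FGammaKdV g₀ x t ((s:ℂ) * Complex.exp (2 * Complex.I * (Real.pi:ℂ) / 3))
        * Complex.exp (2 * Complex.I * (Real.pi:ℂ) / 3))

namespace KdVAux

/-- Time factor of the integrand. -/
noncomputable def hh (g : ℝ → ℂ) (l : ℂ) (t : ℝ) : ℂ :=
  Complex.exp (-(omegaKdV l * (t:ℂ))) * gTildeKdV g l t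

/-- Spatial factor on the ray of direction `a`. -/
noncomputable def EE (a : ℂ) (n : ℕ) (x s : ℝ) : ℂ :=
  Complex.exp (Complex.I * ((s:ℂ) * a) * (x:ℂ)) * ((s:ℂ) * a) ^ n * a

noncomputable def MM (a : ℂ) (n : ℕ) (x : ℝ) : ℂ := ∫ s in Ioi (0:ℝ), EE a n x s

noncomputable def JJ (g : ℝ → ℂ) (a : ℂ) (n : ℕ) (p : ℝ × ℝ) : ℂ :=
  ∫ s in Ioi (0:ℝ), EE a n p.1 s * hh g ((s:ℂ) * a) p.2

/-- Admissible ray directions. -/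
structure Adm (a : ℂ) : Prop where
  nrm : ‖a‖ = 1
  im_pos : 0 < a.im
  cube : (a ^ 3).im = 0

lemma omega_re {a : ℂ} (ha : Adm a) (s : ℝ) : (omegaKdV ((s:ℂ) * a)).re = 0 := by
  have h : omegaKdV ((s:ℂ) * a) = -Complex.I * (((s ^ 3 : ℝ) : ℂ) * a ^ 3) := by
    unfold omegaKdV; push_cast; ring
  rw [h]
  have := ha.cube
  simp only [Complex.mul_re, Complex.neg_re, Complex.neg_im, Complex.I_re, Complex.I_im,
    Complex.mul_im, Complex.ofReal_re, Complex.ofReal_im, this]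
  ring

lemma norm_exp_omega {a : ℂ} (ha : Adm a) (s t : ℝ) :
    ‖Complex.exp (omegaKdV ((s:ℂ) * a) * (t:ℂ))‖ = 1 := by
  rw [Complex.norm_exp, Complex.re_mul_ofReal, omega_re ha]; simp

lemma norm_exp_omega' {a : ℂ} (ha : Adm a) (s t : ℝ) :
    ‖Complex.exp (-(omegaKdV ((s:ℂ) * a) * (t:ℂ)))‖ = 1 := by
  rw [Complex.norm_exp, Complex.neg_re, Complex.re_mul_ofReal, omega_re ha]; simp

lemma continuous_omega : Continuous omegaKdV := by unfold omegaKdV; fun_prop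

lemma norm_hh_le {g : ℝ → ℂ} {a : ℂ} (ha : Adm a) {M T : ℝ}
    (hM : ∀ τ, |τ| ≤ T → ‖g τ‖ ≤ M) (s : ℝ) {t : ℝ} (ht : |t| ≤ T) :
    ‖hh g ((s:ℂ) * a) t‖ ≤ T * M := by
  have hM0 : 0 ≤ M := (norm_nonneg _).trans (hM t ht)
  unfold hh
  rw [norm_mul, norm_exp_omega' ha, one_mul]
  unfold gTildeKdV
  refine (intervalIntegral.norm_integral_le_of_norm_le_const (C := M) ?_).trans ?_
  · intro τ hτ
    rw [norm_mul, norm_exp_omega ha, one_mul]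
    apply hM
    refine le_trans ?_ ht
    rcases le_total 0 t with h | h
    · rw [uIoc_of_le h] at hτ
      rw [abs_of_nonneg h, abs_of_pos hτ.1]; exact hτ.2
    · rw [uIoc_of_ge h] at hτ
      rw [abs_of_nonpos h, abs_of_nonpos hτ.2]; linarith [hτ.1]
  · rw [sub_zero, mul_comm]; gcongr

lemma hh_zero (g : ℝ → ℂ) (l : ℂ) : hh g l 0 = 0 := by simp [hh, gTildeKdV]

lemma continuous_hh {g : ℝ → ℂ} (hg : Continuous g) (a : ℂ) (t : ℝ) :
    Continuous fun s : ℝ => hh g ((s:ℂ) * a) t := by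
  unfold hh gTildeKdV
  have := continuous_omega
  refine Continuous.mul (by fun_prop) ?_
  apply intervalIntegral.continuous_parametric_intervalIntegral_of_continuous'
  unfold Function.uncurry
  fun_prop

lemma hasDerivAt_hh {g : ℝ → ℂ} (hg : Continuous g) (l : ℂ) (t : ℝ) :
    HasDerivAt (hh g l) (Complex.I * l ^ 3 * hh g l t + g t) t := by
  have h1 : HasDerivAt (fun t : ℝ => gTildeKdV g l t)
      (Complex.exp (omegaKdV l * (t:ℂ)) * g t) t := by
    unfold gTildeKdV
    have hc : Continuous fun τ : ℝ => Complex.exp (omegaKdV l * (τ:ℂ)) * g τ := by fun_prop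
    exact intervalIntegral.integral_hasDerivAt_right (hc.intervalIntegrable _ _)
      hc.aestronglyMeasurable.stronglyMeasurableAtFilter hc.continuousAt
  have h2 : HasDerivAt (fun t : ℝ => Complex.exp (-(omegaKdV l * (t:ℂ))))
      (Complex.exp (-(omegaKdV l * (t:ℂ))) * (-(omegaKdV l * 1))) t :=
    (((Complex.ofRealCLM.hasDerivAt (x := t)).const_mul (omegaKdV l)).neg).cexp
  have h3 := h2.mul h1
  have e : Complex.exp (-(omegaKdV l * (t:ℂ))) * Complex.exp (omegaKdV l * (t:ℂ)) = 1 := by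
    rw [← Complex.exp_add]; simp
  refine h3.congr_deriv ?_
  rw [← mul_assoc, e]
  unfold hh
  unfold omegaKdV
  ring

lemma norm_EE {a : ℂ} (ha : Adm a) (n : ℕ) (x : ℝ) {s : ℝ} (hs : 0 < s) :
    ‖EE a n x s‖ = s ^ n * Real.exp (-(a.im * x * s)) := by
  unfold EE
  rw [norm_mul, norm_mul, ha.nrm, mul_one, norm_pow, norm_mul, ha.nrm, mul_one,
    Complex.norm_real, Real.norm_of_nonneg hs.le, Complex.norm_exp, mul_comm]
  congr 2
  simp
  ring

lemma continuous_EE (a : ℂ) (n : ℕ) (x : ℝ) : Continuous (EE a n x) := by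
  unfold EE; fun_prop

lemma integral_pow_exp (n : ℕ) {b : ℝ} (hb : 0 < b) :
    ∫ s in Ioi (0:ℝ), s ^ n * Real.exp (-(b * s)) = (1 / b) ^ (n + 1) * (n.factorial : ℝ) := by
  have h := Real.integral_rpow_mul_exp_neg_mul_Ioi (a := (n:ℝ) + 1) (r := b) (by positivity) hb
  rw [Real.Gamma_nat_eq_factorial] at h
  rw [← Nat.cast_succ, Real.rpow_natCast] at h
  rw [← h]
  refine setIntegral_congr_fun measurableSet_Ioi fun s hs => ?_
  simp

lemma integrable_pow_exp (n : ℕ) {b : ℝ} (hb : 0 < b) :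
    IntegrableOn (fun s : ℝ => s ^ n * Real.exp (-(b * s))) (Ioi 0) := by
  by_contra h
  have h1 := integral_pow_exp n hb
  rw [integral_undef h] at h1
  have : 0 < (1 / b) ^ (n + 1) * (n.factorial : ℝ) := by positivity
  linarith

lemma integrable_EE {a : ℂ} (ha : Adm a) (n : ℕ) {x : ℝ} (hx : 0 < x) :
    IntegrableOn (EE a n x) (Ioi 0) := by
  refine Integrable.mono' (integrable_pow_exp n (mul_pos ha.im_pos hx))
    (continuous_EE a n x).aestronglyMeasurable ?_
  filter_upwards [ae_restrict_mem measurableSet_Ioi] with s hs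
  rw [norm_EE ha n x hs]

lemma exists_bound {g : ℝ → ℂ} (hg : Continuous g) (T : ℝ) :
    ∃ M, 0 ≤ M ∧ ∀ τ, |τ| ≤ T → ‖g τ‖ ≤ M := by
  obtain ⟨M, hM⟩ := (isCompact_Icc (a := -T) (b := T)).exists_bound_of_continuousOn
    hg.continuousOn
  exact ⟨max M 0, le_max_right _ _, fun τ hτ => (hM τ (abs_le.1 hτ)).trans (le_max_left _ _)⟩

lemma norm_integrand_le {g : ℝ → ℂ} {a : ℂ} (ha : Adm a) {M T : ℝ}
    (hM : ∀ τ, |τ| ≤ T → ‖g τ‖ ≤ M) (n : ℕ) (x : ℝ) {s : ℝ} (hs : 0 < s)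
    {t : ℝ} (ht : |t| ≤ T) :
    ‖EE a n x s * hh g ((s:ℂ) * a) t‖ ≤ s ^ n * Real.exp (-(a.im * x * s)) * (T * M) := by
  rw [norm_mul, norm_EE ha n x hs]
  gcongr
  exact norm_hh_le ha hM s ht

lemma integrable_integrand {g : ℝ → ℂ} (hg : Continuous g) {a : ℂ} (ha : Adm a) (n : ℕ)
    {x : ℝ} (hx : 0 < x) (t : ℝ) :
    IntegrableOn (fun s : ℝ => EE a n x s * hh g ((s:ℂ) * a) t) (Ioi 0) := by
  obtain ⟨M, -, hM⟩ := exists_bound hg |t|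
  refine Integrable.mono' ((integrable_pow_exp n (mul_pos ha.im_pos hx)).mul_const (|t| * M))
    ((continuous_EE a n x).mul (continuous_hh hg a t)).aestronglyMeasurable ?_
  filter_upwards [ae_restrict_mem measurableSet_Ioi] with s hs
  exact norm_integrand_le ha hM n x hs le_rfl

lemma norm_JJ_le {g : ℝ → ℂ} {a : ℂ} (ha : Adm a) {M T : ℝ}
    (hM : ∀ τ, |τ| ≤ T → ‖g τ‖ ≤ M) (n : ℕ) {x : ℝ} (hx : 0 < x)
    {t : ℝ} (ht : |t| ≤ T) :
    ‖JJ g a n (x, t)‖ ≤ (1 / a.im) ^ (n + 1) * (n.factorial : ℝ) * (T * M) / x ^ (n + 1) := by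
  have hb := mul_pos ha.im_pos hx
  have h : ‖JJ g a n (x, t)‖ ≤
      ∫ s in Ioi (0:ℝ), s ^ n * Real.exp (-(a.im * x * s)) * (T * M) := by
    refine norm_integral_le_of_norm_le ((integrable_pow_exp n hb).mul_const (T * M)) ?_
    filter_upwards [ae_restrict_mem measurableSet_Ioi] with s hs
    exact norm_integrand_le ha hM n x hs ht
  rw [integral_mul_const, integral_pow_exp n hb] at h
  refine h.trans (le_of_eq ?_)
  rw [one_div_pow, one_div_pow, mul_pow]
  have := ha.im_pos
  field_simp

lemma hasDerivAt_ray (a : ℂ) (n : ℕ) (x s : ℝ) :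
    HasDerivAt (fun s : ℝ => Complex.exp (Complex.I * ((s:ℂ) * a) * (x:ℂ)) * ((s:ℂ) * a) ^ n)
      (Complex.I * x * EE a n x s + n * EE a (n - 1) x s) s := by
  have h0 : HasDerivAt (fun s : ℝ => (s:ℂ) * a) (1 * a) s :=
    (Complex.ofRealCLM.hasDerivAt (x := s)).mul_const a
  have h1 := ((h0.const_mul Complex.I).mul_const (x:ℂ)).cexp
  refine (h1.mul (h0.pow n)).congr_deriv ?_
  unfold EE
  simp only [Pi.pow_apply]
  ring

lemma tendsto_ray {a : ℂ} (ha : Adm a) (n : ℕ) {x : ℝ} (hx : 0 < x) :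
    Tendsto (fun s : ℝ => Complex.exp (Complex.I * ((s:ℂ) * a) * (x:ℂ)) * ((s:ℂ) * a) ^ n)
      atTop (𝓝 0) := by
  have hb := mul_pos ha.im_pos hx
  have h := tendsto_rpow_mul_exp_neg_mul_atTop_nhds_zero (n:ℝ) _ hb
  refine squeeze_zero_norm' ?_ h
  filter_upwards [eventually_gt_atTop 0] with s hs
  have := norm_EE ha n x hs
  unfold EE at this
  rw [norm_mul, ha.nrm, mul_one] at this
  rw [this, Real.rpow_natCast, neg_mul]

lemma MM_rec {a : ℂ} (ha : Adm a) (n : ℕ) {x : ℝ} (hx : 0 < x) :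
    Complex.I * x * MM a n x + n * MM a (n - 1) x = - (0:ℂ) ^ n := by
  have i1 := (integrable_EE ha n hx).const_mul (Complex.I * x)
  have i2 := (integrable_EE ha (n - 1) hx).const_mul (n:ℂ)
  have h := integral_Ioi_of_hasDerivAt_of_tendsto' (a := (0:ℝ))
    (fun s _ => hasDerivAt_ray a n x s) (i1.add i2) (tendsto_ray ha n hx)
  rw [integral_add i1 i2, integral_const_mul, integral_const_mul] at h
  unfold MM
  rw [h]; simp

lemma MM_eq {a b : ℂ} (ha : Adm a) (hb : Adm b) {x : ℝ} (hx : 0 < x) (n : ℕ) :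
    MM a n x = MM b n x := by
  have hI : Complex.I * (x:ℂ) ≠ 0 := by simp [hx.ne']
  induction n with
  | zero =>
    have h1 := MM_rec ha 0 hx
    have h2 := MM_rec hb 0 hx
    apply mul_left_cancel₀ hI
    simp only [Nat.cast_zero, zero_mul, add_zero] at h1 h2
    rw [h1, h2]
  | succ n ih =>
    have h1 := MM_rec ha (n + 1) hx
    have h2 := MM_rec hb (n + 1) hx
    apply mul_left_cancel₀ hI
    simp only [Nat.add_sub_cancel, ih] at h1 h2
    exact add_right_cancel (h1.trans h2.symm)

/-- linear map with given partial derivatives -/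
noncomputable def LL (u v : ℂ) : ℝ × ℝ →L[ℝ] ℂ :=
  (ContinuousLinearMap.fst ℝ ℝ ℝ).smulRight u + (ContinuousLinearMap.snd ℝ ℝ ℝ).smulRight v

lemma LL_apply (u v : ℂ) (p : ℝ × ℝ) : LL u v p = p.1 • u + p.2 • v := rfl

lemma norm_LL_le (u v : ℂ) : ‖LL u v‖ ≤ ‖u‖ + ‖v‖ := by
  refine ContinuousLinearMap.opNorm_le_bound _ (by positivity) fun p => ?_
  rw [LL_apply]
  refine (norm_add_le _ _).trans ?_
  rw [norm_smul, norm_smul, add_mul, mul_comm ‖u‖, mul_comm ‖v‖]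
  gcongr
  · exact norm_fst_le p
  · exact norm_snd_le p

lemma LL_eq (u v : ℂ) : LL u v =
    ContinuousLinearMap.smulRightL ℝ (ℝ × ℝ) ℂ (ContinuousLinearMap.fst ℝ ℝ ℝ) u +
    ContinuousLinearMap.smulRightL ℝ (ℝ × ℝ) ℂ (ContinuousLinearMap.snd ℝ ℝ ℝ) v := rfl

lemma continuous_LL {X : Type*} [TopologicalSpace X] {u v : X → ℂ} (hu : Continuous u)
    (hv : Continuous v) : Continuous fun s => LL (u s) (v s) := by
  simp only [LL_eq]; fun_prop

lemma contDiffOn_LL {n : WithTop ℕ∞} {S : Set (ℝ × ℝ)} {u v : ℝ × ℝ → ℂ}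
    (hu : ContDiffOn ℝ n u S) (hv : ContDiffOn ℝ n v S) :
    ContDiffOn ℝ n (fun s => LL (u s) (v s)) S := by
  simp only [LL_eq]
  exact ((ContinuousLinearMap.contDiff _).comp_contDiffOn hu).add
    ((ContinuousLinearMap.contDiff _).comp_contDiffOn hv)

lemma hasFDerivAt_integrand {g : ℝ → ℂ} (hg : Continuous g) (a : ℂ) (n : ℕ) (s : ℝ)
    (p : ℝ × ℝ) :
    HasFDerivAt (fun p : ℝ × ℝ => EE a n p.1 s * hh g ((s:ℂ) * a) p.2)
      (LL (Complex.I * (EE a (n + 1) p.1 s * hh g ((s:ℂ) * a) p.2))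
        (Complex.I * (EE a (n + 3) p.1 s * hh g ((s:ℂ) * a) p.2) + EE a n p.1 s * g p.2)) p := by
  have h1 : HasDerivAt (fun x : ℝ => EE a n x s) (Complex.I * EE a (n + 1) p.1 s) p.1 := by
    have := (((Complex.ofRealCLM.hasDerivAt (x := p.1)).const_mul
      (Complex.I * ((s:ℂ) * a))).cexp.mul_const (((s:ℂ) * a) ^ n)).mul_const a
    refine this.congr_deriv ?_
    unfold EE
    simp only [Complex.ofRealCLM_apply, Complex.ofReal_one]
    ring
  have h2 := hasDerivAt_hh hg ((s:ℂ) * a) p.2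
  have h1' := h1.hasFDerivAt.comp p (hasFDerivAt_fst (𝕜 := ℝ) (p := p))
  have h2' := h2.hasFDerivAt.comp p (hasFDerivAt_snd (𝕜 := ℝ) (p := p))
  refine (h1'.mul h2').congr_fderiv ?_
  ext
  all_goals
    simp [LL_apply]
    try unfold EE
    try ring

lemma hasFDerivAt_JJ {g : ℝ → ℂ} (hg : Continuous g) {a : ℂ} (ha : Adm a) (n : ℕ)
    (p : ℝ × ℝ) (hp : 0 < p.1) :
    HasFDerivAt (JJ g a n) (LL (Complex.I * JJ g a (n + 1) p)
      (Complex.I * JJ g a (n + 3) p + MM a n p.1 * g p.2)) p := by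
  set F' : ℝ × ℝ → ℝ → (ℝ × ℝ →L[ℝ] ℂ) := fun p s =>
    LL (Complex.I * (EE a (n + 1) p.1 s * hh g ((s:ℂ) * a) p.2))
        (Complex.I * (EE a (n + 3) p.1 s * hh g ((s:ℂ) * a) p.2) + EE a n p.1 s * g p.2)
    with hF'
  set T := |p.2| + 1 with hT
  obtain ⟨M, hM0, hM⟩ := exists_bound hg T
  have hT0 : 0 ≤ T := by positivity
  have hb : 0 < a.im * (p.1 / 2) := mul_pos ha.im_pos (by linarith)
  set S : Set (ℝ × ℝ) := {q | p.1 / 2 < q.1 ∧ |q.2| < T} with hS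
  have hSn : S ∈ 𝓝 p := by
    have o1 : IsOpen {q : ℝ × ℝ | p.1 / 2 < q.1} := isOpen_lt (by fun_prop) (by fun_prop)
    have o2 : IsOpen {q : ℝ × ℝ | |q.2| < T} := isOpen_lt (by fun_prop) (by fun_prop)
    have : IsOpen S := o1.inter o2
    exact this.mem_nhds ⟨by linarith, by rw [hT]; linarith⟩
  set P : ℕ → ℝ → ℝ := fun n s => s ^ n * Real.exp (-(a.im * (p.1 / 2) * s)) with hP
  have hPi : ∀ n, IntegrableOn (P n) (Ioi 0) := fun n => integrable_pow_exp n hb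
  have hEP : ∀ n, ∀ q ∈ S, ∀ s : ℝ, 0 < s → s ^ n * Real.exp (-(a.im * q.1 * s)) ≤ P n s := by
    intro n q hq s hs
    have h1 := hq.1.le
    have := ha.im_pos
    simp only [hP]
    gcongr
  have hbd : ∀ᵐ s ∂(volume.restrict (Ioi (0:ℝ))), ∀ q ∈ S,
      ‖F' q s‖ ≤ P (n + 1) s * (T * M) + (P (n + 3) s * (T * M) + P n s * M) := by
    filter_upwards [ae_restrict_mem measurableSet_Ioi] with s hs q hq
    have hs : 0 < s := hs
    have hTM : 0 ≤ T * M := by positivity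
    refine (norm_LL_le _ _).trans (add_le_add ?_ ((norm_add_le _ _).trans (add_le_add ?_ ?_)))
    · rw [norm_mul, Complex.norm_I, one_mul]
      exact (norm_integrand_le ha hM _ _ hs hq.2.le).trans
        (mul_le_mul_of_nonneg_right (hEP _ q hq s hs) hTM)
    · rw [norm_mul, Complex.norm_I, one_mul]
      exact (norm_integrand_le ha hM _ _ hs hq.2.le).trans
        (mul_le_mul_of_nonneg_right (hEP _ q hq s hs) hTM)
    · rw [norm_mul, norm_EE ha _ _ hs]
      exact mul_le_mul (hEP _ q hq s hs) (hM _ hq.2.le) (norm_nonneg _) (by positivity)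
  have hbi : Integrable (fun s => P (n + 1) s * (T * M) + (P (n + 3) s * (T * M) + P n s * M))
      (volume.restrict (Ioi (0:ℝ))) :=
    ((hPi _).mul_const _).add (((hPi _).mul_const _).add ((hPi _).mul_const _))
  have hcF' : Continuous (F' p) := by
    have := continuous_hh hg a p.2
    have := continuous_EE a n p.1
    have := continuous_EE a (n + 1) p.1
    have := continuous_EE a (n + 3) p.1
    exact continuous_LL (by fun_prop) (by fun_prop)
  have key := hasFDerivAt_integral_of_dominated_of_fderiv_le (𝕜 := ℝ)
    (μ := volume.restrict (Ioi (0:ℝ)))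
    (F := fun (p : ℝ × ℝ) s => EE a n p.1 s * hh g ((s:ℂ) * a) p.2) (F' := F') (x₀ := p) hSn
    (Eventually.of_forall fun q =>
      ((continuous_EE a n q.1).mul (continuous_hh hg a q.2)).aestronglyMeasurable)
    (integrable_integrand hg ha n hp p.2) hcF'.aestronglyMeasurable hbd hbi
    (Eventually.of_forall fun s q _ => hasFDerivAt_integrand hg a n s q)
  refine key.congr_fderiv ?_
  have hF'i : Integrable (F' p) (volume.restrict (Ioi (0:ℝ))) :=
    hbi.mono' hcF'.aestronglyMeasurable (hbd.mono fun s h => h p (mem_of_mem_nhds hSn))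
  apply ContinuousLinearMap.ext
  intro v
  rw [ContinuousLinearMap.integral_apply hF'i]
  simp only [hF', LL_apply]
  have i1 := (integrable_integrand hg ha (n + 1) hp p.2).const_mul Complex.I
  have i3 := (integrable_integrand hg ha (n + 3) hp p.2).const_mul Complex.I
  have i0 := (integrable_EE ha n hp).mul_const (g p.2)
  refine (integral_add (i1.smul v.1) ((i3.add i0).smul v.2)).trans ?_
  simp only [Pi.smul_apply, Pi.add_apply]
  rw [integral_smul, integral_smul,
    integral_add i3 i0, integral_const_mul, integral_const_mul, integral_mul_const]
  rfl

/-- The difference of the two ray integrals. -/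
noncomputable def DD (g : ℝ → ℂ) (a b : ℂ) (n : ℕ) (p : ℝ × ℝ) : ℂ := JJ g a n p - JJ g b n p

section
variable {g : ℝ → ℂ} (hg : Continuous g) {a b : ℂ} (ha : Adm a) (hb : Adm b)

lemma hasFDerivAt_DD (hg : Continuous g) (ha : Adm a) (hb : Adm b) (n : ℕ)
    (p : ℝ × ℝ) (hp : 0 < p.1) :
    HasFDerivAt (DD g a b n) (LL (Complex.I * DD g a b (n + 1) p)
      (Complex.I * DD g a b (n + 3) p)) p := by
  refine ((hasFDerivAt_JJ hg ha n p hp).sub (hasFDerivAt_JJ hg hb n p hp)).congr_fderiv ?_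
  apply ContinuousLinearMap.ext
  intro v
  rw [sub_apply]
  simp only [LL_apply, DD, MM_eq ha hb hp n, Complex.real_smul]
  ring

lemma contDiffOn_DD (hg : Continuous g) (ha : Adm a) (hb : Adm b) (N : ℕ) (n : ℕ) :
    ContDiffOn ℝ N (DD g a b n) (Ioi (0:ℝ) ×ˢ Ioi (0:ℝ)) := by
  have ho : IsOpen (Ioi (0:ℝ) ×ˢ Ioi (0:ℝ)) := isOpen_Ioi.prod isOpen_Ioi
  induction N generalizing n with
  | zero =>
    rw [Nat.cast_zero, contDiffOn_zero]
    exact fun p hp => (hasFDerivAt_DD hg ha hb n p hp.1).continuousAt.continuousWithinAt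
  | succ N ih =>
    rw [Nat.cast_succ, contDiffOn_succ_iff_fderiv_of_isOpen ho]
    refine ⟨fun p hp => (hasFDerivAt_DD hg ha hb n p hp.1).differentiableAt.differentiableWithinAt,
      fun h => by simp at h, ?_⟩
    refine (contDiffOn_LL (contDiffOn_const.mul (ih (n + 1)))
      (contDiffOn_const.mul (ih (n + 3)))).congr fun p hp =>
        (hasFDerivAt_DD hg ha hb n p hp.1).fderiv

lemma hasDerivAt_DD_x (hg : Continuous g) (ha : Adm a) (hb : Adm b) (n : ℕ)
    {x : ℝ} (hx : 0 < x) (t : ℝ) :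
    HasDerivAt (fun y => DD g a b n (y, t)) (Complex.I * DD g a b (n + 1) (x, t)) x := by
  have h := (hasFDerivAt_DD hg ha hb n (x, t) hx).comp_hasDerivAt x
    ((hasDerivAt_id x).prodMk (hasDerivAt_const x t))
  refine h.congr_deriv ?_
  simp [LL_apply]

lemma hasDerivAt_DD_t (hg : Continuous g) (ha : Adm a) (hb : Adm b) (n : ℕ)
    {x : ℝ} (hx : 0 < x) (t : ℝ) :
    HasDerivAt (fun s => DD g a b n (x, s)) (Complex.I * DD g a b (n + 3) (x, t)) t := by
  have h := (hasFDerivAt_DD hg ha hb n (x, t) hx).comp_hasDerivAt t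
    ((hasDerivAt_const t x).prodMk (hasDerivAt_id t))
  refine h.congr_deriv ?_
  simp [LL_apply]

lemma DD_zero (n : ℕ) (x : ℝ) : DD g a b n (x, 0) = 0 := by
  simp [DD, JJ, hh_zero]

lemma DD_decay (hg : Continuous g) (ha : Adm a) (hb : Adm b) {T : ℝ} (hT : 0 < T) (N n : ℕ) :
    ∃ C, 0 ≤ C ∧ ∀ x > 0, ∀ t ∈ Icc 0 T, ‖DD g a b n (x, t)‖ ≤ C / x ^ (n + 3 * N + 1) := by
  induction N generalizing n with
  | zero =>
    obtain ⟨M, hM0, hM⟩ := exists_bound hg T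
    have := ha.im_pos
    have := hb.im_pos
    refine ⟨(1 / a.im) ^ (n + 1) * (n.factorial : ℝ) * (T * M) +
      (1 / b.im) ^ (n + 1) * (n.factorial : ℝ) * (T * M), by positivity, fun x hx t ht => ?_⟩
    have ht' : |t| ≤ T := by rw [abs_of_nonneg ht.1]; exact ht.2
    refine (norm_sub_le _ _).trans ?_
    rw [add_div]
    exact add_le_add (norm_JJ_le ha hM n hx ht') (norm_JJ_le hb hM n hx ht')
  | succ N ih =>
    obtain ⟨C, hC0, hC⟩ := ih (n + 3)
    refine ⟨C * T, by positivity, fun x hx t ht => ?_⟩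
    have h := norm_image_sub_le_of_norm_deriv_le_segment' (a := (0:ℝ)) (b := T)
      (f := fun s => DD g a b n (x, s)) (C := C / x ^ (n + 3 + 3 * N + 1))
      (fun s _ => (hasDerivAt_DD_t hg ha hb n hx s).hasDerivWithinAt)
      (fun s hs => by
        rw [norm_mul, Complex.norm_I, one_mul]
        exact hC x hx s ⟨hs.1, hs.2.le⟩) t ht
    simp only [DD_zero, sub_zero] at h
    refine h.trans ?_
    rw [show n + 3 * (N + 1) + 1 = n + 3 + 3 * N + 1 by ring, mul_div_right_comm]
    gcongr
    exact ht.2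

lemma iteratedDeriv_DD_t (hg : Continuous g) (ha : Adm a) (hb : Adm b) {f : ℝ → ℂ} {c : ℂ}
    {n : ℕ} {x : ℝ} (hx : 0 < x) (hf : ∀ t > 0, f t = c * DD g a b n (x, t)) (m : ℕ) :
    ∀ t > 0, iteratedDeriv m f t = c * Complex.I ^ m * DD g a b (n + 3 * m) (x, t) := by
  induction m with
  | zero => intro t ht; simpa using hf t ht
  | succ m ih =>
    intro t ht
    rw [iteratedDeriv_succ]
    have he : iteratedDeriv m f =ᶠ[𝓝 t]
        fun t => c * Complex.I ^ m * DD g a b (n + 3 * m) (x, t) := by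
      filter_upwards [Ioi_mem_nhds ht] with s hs using ih s hs
    rw [he.deriv_eq, ((hasDerivAt_DD_t hg ha hb _ hx t).const_mul _).deriv,
      show n + 3 * (m + 1) = n + 3 * m + 3 by ring]
    ring

lemma iteratedDeriv_DD_x (hg : Continuous g) (ha : Adm a) (hb : Adm b) {f : ℝ → ℂ} {c : ℂ}
    {n : ℕ} {t : ℝ} (hf : ∀ x > 0, f x = c * DD g a b n (x, t)) (k : ℕ) :
    ∀ x > 0, iteratedDeriv k f x = c * Complex.I ^ k * DD g a b (n + k) (x, t) := by
  induction k with
  | zero => intro t ht; simpa using hf t ht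
  | succ k ih =>
    intro x hx
    rw [iteratedDeriv_succ]
    have he : iteratedDeriv k f =ᶠ[𝓝 x]
        fun x => c * Complex.I ^ k * DD g a b (n + k) (x, t) := by
      filter_upwards [Ioi_mem_nhds hx] with s hs using ih s hs
    rw [he.deriv_eq, ((hasDerivAt_DD_x hg ha hb _ hx t).const_mul _).deriv,
      show n + (k + 1) = n + k + 1 by ring]
    ring
end

lemma adm1 : Adm (Complex.exp (Complex.I * (Real.pi:ℂ) / 3)) := by
  have e : Complex.I * (Real.pi:ℂ) / 3 = ((Real.pi / 3 : ℝ) : ℂ) * Complex.I := by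
    push_cast; ring
  refine ⟨?_, ?_, ?_⟩
  · rw [e, Complex.norm_exp_ofReal_mul_I]
  · rw [e, Complex.exp_ofReal_mul_I_im]
    exact Real.sin_pos_of_pos_of_lt_pi (by positivity) (by linarith [Real.pi_pos])
  · rw [← Complex.exp_nat_mul, show ((3:ℕ):ℂ) * (Complex.I * (Real.pi:ℂ) / 3)
      = (Real.pi:ℂ) * Complex.I by push_cast; ring, Complex.exp_pi_mul_I]
    simp

lemma adm2 : Adm (Complex.exp (2 * Complex.I * (Real.pi:ℂ) / 3)) := by
  have e : 2 * Complex.I * (Real.pi:ℂ) / 3 = ((2 * Real.pi / 3 : ℝ) : ℂ) * Complex.I := by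
    push_cast; ring
  refine ⟨?_, ?_, ?_⟩
  · rw [e, Complex.norm_exp_ofReal_mul_I]
  · rw [e, Complex.exp_ofReal_mul_I_im]
    exact Real.sin_pos_of_pos_of_lt_pi (by positivity) (by linarith [Real.pi_pos])
  · rw [← Complex.exp_nat_mul, show ((3:ℕ):ℂ) * (2 * Complex.I * (Real.pi:ℂ) / 3)
      = 2 * (Real.pi:ℂ) * Complex.I by push_cast; ring, Complex.exp_two_pi_mul_I]
    simp

lemma ray_eq {g₀ g : ℝ → ℂ} (hgg : ∀ τ, 0 ≤ τ → g τ = g₀ τ) (a : ℂ) (x : ℝ) {t : ℝ}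
    (ht : 0 < t) :
    ∫ s in Ioi (0:ℝ), FGammaKdV g₀ x t ((s:ℂ) * a) * a = 3 * JJ g a 2 (x, t) := by
  unfold JJ
  rw [← integral_const_mul]
  congr 1
  funext s
  have hG : gTildeKdV g₀ ((s:ℂ) * a) t = gTildeKdV g ((s:ℂ) * a) t := by
    unfold gTildeKdV
    refine intervalIntegral.integral_congr fun τ hτ => ?_
    rw [uIcc_of_le ht.le] at hτ
    simp only [hgg τ hτ.1]
  unfold FGammaKdV EE hh
  rw [hG, sub_eq_add_neg, Complex.exp_add]
  ring

lemma Ig_eq {g₀ g : ℝ → ℂ} (hgg : ∀ τ, 0 ≤ τ → g τ = g₀ τ) (x : ℝ) {t : ℝ} (ht : 0 < t) :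
    IgKdV g₀ x t = 3 * DD g (Complex.exp (Complex.I * (Real.pi:ℂ) / 3))
      (Complex.exp (2 * Complex.I * (Real.pi:ℂ) / 3)) 2 (x, t) := by
  unfold IgKdV DD
  rw [ray_eq hgg _ x ht, ray_eq hgg _ x ht, mul_sub]

end KdVAux

open KdVAux
theorem stmt8 (g₀ : ℝ → ℂ) (hg : ContDiffOn ℝ (⊤:ℕ∞) g₀ (Ici (0:ℝ))) :
    ContDiffOn ℝ (⊤:ℕ∞) (fun p : ℝ × ℝ => IgKdV g₀ p.1 p.2) (Ioi (0:ℝ) ×ˢ Ioi (0:ℝ)) ∧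
    ∀ k m l : ℕ, ∀ T₀ > (0:ℝ), ∀ δ > (0:ℝ), ∃ X : ℝ, ∀ x ≥ X, ∀ t ∈ Ioc (0:ℝ) T₀,
      x ^ l *
        ‖iteratedDeriv k (fun y => iteratedDeriv m (fun s => IgKdV g₀ y s) t) x‖ < δ := by
  obtain ⟨g, hgc, hgg⟩ : ∃ g : ℝ → ℂ, Continuous g ∧ ∀ τ, 0 ≤ τ → g τ = g₀ τ := by
    refine ⟨fun τ => g₀ (max τ 0), ?_, fun τ hτ => by simp [max_eq_left hτ]⟩
    exact hg.continuousOn.comp_continuous (by fun_prop) fun τ =>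
      mem_Ici.2 (le_max_right _ _)
  have ha := adm1
  have hb := adm2
  constructor
  · rw [contDiffOn_infty]
    intro N
    exact (contDiffOn_const.mul (contDiffOn_DD hgc ha hb N 2)).congr
      fun p hp => Ig_eq hgg p.1 hp.2
  · intro k m l T₀ hT δ hδ
    obtain ⟨C, hC0, hC⟩ := DD_decay hgc ha hb hT l (2 + 3 * m + k)
    refine ⟨max 1 (3 * C / δ + 1), fun x hx t ht => ?_⟩
    have hx1 : 1 ≤ x := (le_max_left _ _).trans hx
    have hx2 : 3 * C / δ + 1 ≤ x := (le_max_right _ _).trans hx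
    have hx0 : 0 < x := by linarith
    have h1 : ∀ y > 0, iteratedDeriv m (fun s => IgKdV g₀ y s) t =
        3 * Complex.I ^ m * _ := fun y hy =>
      iteratedDeriv_DD_t hgc ha hb hy (fun t ht => Ig_eq hgg y ht) m t ht.1
    rw [iteratedDeriv_DD_x hgc ha hb h1 k x hx0]
    have h2 := hC x hx0 t ⟨ht.1.le, ht.2⟩
    rw [norm_mul, norm_mul, norm_mul, norm_pow, norm_pow, Complex.norm_I, one_pow, one_pow,
      mul_one, mul_one, Complex.norm_ofNat]
    have h3 : C / x ^ (2 + 3 * m + k + 3 * l + 1) ≤ C / x ^ (l + 1) := by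
      have : l + 1 ≤ 2 + 3 * m + k + 3 * l + 1 := by omega
      exact div_le_div_of_nonneg_left hC0 (by positivity) (pow_le_pow_right₀ hx1 this)
    calc x ^ l * (3 * _) ≤ x ^ l * (3 * (C / x ^ (l + 1))) := by
          gcongr; exact h2.trans h3
      _ = 3 * C / x := by rw [pow_succ]; field_simp
      _ < δ := by
          rw [div_lt_iff₀ hx0]
          have : 3 * C / δ < x := by linarith
          rw [div_lt_iff₀ hδ] at this
          linarith
end

section
/- Let W be a real-valued function of class C³ on ([0,∞)×[0,∞)) ∖ {(0,0)} satisfying: (i) W_t = −W_{xxx} on Q; (ii) W(x,0) = 0 for all x > 0 and W(0,t) = 0 for all t > 0; (iii) for every t > 0, lim_{x→∞} W(x,t) = 0, lim_{x→∞} W_x(x,t) = 0, and sup_{x ≥ 1} |W_{xx}(x,t)| < ∞; (iv) for every T > 0 there exists a function B_T : (0,∞) → [0,∞) with ∫₀^∞ B_T(x) dx < ∞ such that |W(x,t)|² ≤ B_T(x) and |W_t(x,t)|² ≤ B_T(x) for all x > 0 and 0 < t ≤ T. Then W ≡ 0 on Q. In particular, any two solutions of the Dirichlet initial-boundary-value problem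 for the forced linearized KdV equation U_t + U_{xxx} = f on Q with the same data, each satisfying conditions (iii) and (iv), coincide. -/
open MeasureTheory Filter Set Topology

/-- Energy inequality in one variable: the integral of g times its third derivative is nonnegative. -/
theorem half_line_energy (g : ℝ → ℝ) (hg : ContDiffOn ℝ 3 g (Ici 0)) (h0 : g 0 = 0)
    (hl : Tendsto g atTop (𝓝 0)) (hl' : Tendsto (deriv g) atTop (𝓝 0))
    (hb : ∃ C : ℝ, ∀ x ≥ (1:ℝ), |iteratedDeriv 2 g x| ≤ C)
    (hint : IntegrableOn (fun x => g x * iteratedDeriv 3 g x) (Ioi 0)) :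
    0 ≤ ∫ x in Ioi (0:ℝ), g x * iteratedDeriv 3 g x := by
  have hu : UniqueDiffOn ℝ (Ici (0:ℝ)) := uniqueDiffOn_Ici 0
  have hev : ∀ x > (0:ℝ), Ici (0:ℝ) ∈ 𝓝 x := fun x hx => Ici_mem_nhds hx
  have hat : ∀ x > (0:ℝ), ContDiffAt ℝ 3 g x := fun x hx => hg.contDiffAt (hev x hx)
  have heq : ∀ n : ℕ, n ≤ 3 → ∀ x > (0:ℝ),
      iteratedDerivWithin n g (Ici 0) x = iteratedDeriv n g x := by
    intro n hn x hx
    exact iteratedDerivWithin_eq_iteratedDeriv hu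
      ((hat x hx).of_le (by exact_mod_cast hn)) hx.le
  have hder : ∀ n : ℕ, n < 3 → ∀ x > (0:ℝ),
      HasDerivAt (iteratedDerivWithin n g (Ici 0)) (iteratedDeriv (n+1) g x) x := by
    intro n hn x hx
    have h1 : DifferentiableAt ℝ (iteratedDerivWithin n g (Ici 0)) x :=
      (hg.differentiableOn_iteratedDerivWithin (by exact_mod_cast hn) hu x hx.le).differentiableAt
        (hev x hx)
    have h2 := h1.hasDerivAt
    rwa [← derivWithin_of_mem_nhds (hev x hx), ← iteratedDerivWithin_succ,
      heq (n+1) hn x hx] at h2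
  have hcont : ∀ n : ℕ, n ≤ 3 → ContinuousOn (iteratedDerivWithin n g (Ici 0)) (Ici 0) :=
    fun n hn => hg.continuousOn_iteratedDerivWithin (by exact_mod_cast hn) hu
  set G : ℝ → ℝ := fun x => iteratedDerivWithin 0 g (Ici 0) x * iteratedDerivWithin 2 g (Ici 0) x
    - (iteratedDerivWithin 1 g (Ici 0) x)^2 / 2 with hG
  have hGc : ContinuousOn G (Ici 0) :=
    ((hcont 0 (by norm_num)).mul (hcont 2 (by norm_num))).sub
      (((hcont 1 (by norm_num)).pow 2).div_const 2)
  have hGd : ∀ x ∈ Ioi (0:ℝ), HasDerivAt G (g x * iteratedDeriv 3 g x) x := by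
    intro x hx
    have := ((hder 0 (by norm_num) x hx).mul (hder 2 (by norm_num) x hx)).sub
      (((hder 1 (by norm_num) x hx).pow 2).div_const 2)
    refine this.congr_deriv ?_
    rw [heq 1 (by norm_num) x hx, heq 2 (by norm_num) x hx, heq 0 (by norm_num) x hx]
    simp only [iteratedDeriv_zero]
    norm_num
    ring
  have hGl : Tendsto G atTop (𝓝 0) := by
    obtain ⟨C, hC⟩ := hb
    have h1 : Tendsto (fun x => g x * iteratedDeriv 2 g x) atTop (𝓝 0) := by
      refine squeeze_zero_norm' (a := fun x => |g x| * C) ?_ (by simpa using hl.abs.mul_const C)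
      filter_upwards [eventually_ge_atTop 1] with x hx
      rw [Real.norm_eq_abs, abs_mul]
      exact mul_le_mul_of_nonneg_left (hC x hx) (abs_nonneg _)
    have h2 := h1.sub ((hl'.pow 2).div_const 2)
    norm_num at h2
    refine h2.congr' ?_
    filter_upwards [eventually_gt_atTop 0] with x hx
    simp only [hG]
    rw [heq 1 (by norm_num) x hx, heq 2 (by norm_num) x hx, heq 0 (by norm_num) x hx]
    simp [iteratedDeriv_one]
  rw [integral_Ioi_of_hasDerivAt_of_tendsto (hGc 0 (by simp)) hGd hint hGl]
  have : G 0 = - (iteratedDerivWithin 1 g (Ici 0) 0)^2 / 2 := by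
    simp only [hG, iteratedDerivWithin_zero, h0]; ring
  rw [this]
  nlinarith [sq_nonneg (iteratedDerivWithin 1 g (Ici 0) 0)]

theorem stmt9 (W : ℝ → ℝ → ℝ)
    (hreg : ContDiffOn ℝ 3 (fun p : ℝ × ℝ => W p.1 p.2)
      ((Ici (0:ℝ) ×ˢ Ici (0:ℝ)) \ {((0:ℝ), (0:ℝ))}))
    (hpde : ∀ x > (0:ℝ), ∀ t > (0:ℝ),
      deriv (fun s => W x s) t = -(iteratedDeriv 3 (fun y => W y t) x))
    (hinit : ∀ x > (0:ℝ), W x 0 = 0)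
    (hbdry : ∀ t > (0:ℝ), W 0 t = 0)
    (hlim : ∀ t > (0:ℝ), Tendsto (fun x => W x t) atTop (𝓝 0))
    (hlim' : ∀ t > (0:ℝ), Tendsto (fun x => deriv (fun y => W y t) x) atTop (𝓝 0))
    (hbd : ∀ t > (0:ℝ), ∃ C : ℝ, ∀ x ≥ (1:ℝ), |iteratedDeriv 2 (fun y => W y t) x| ≤ C)
    (hB : ∀ T > (0:ℝ), ∃ B : ℝ → ℝ, (∀ x > (0:ℝ), 0 ≤ B x) ∧
      IntegrableOn B (Ioi (0:ℝ)) ∧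
      ∀ x > (0:ℝ), ∀ t ∈ Ioc (0:ℝ) T,
        (W x t)^2 ≤ B x ∧ (deriv (fun s => W x s) t)^2 ≤ B x) :
    ∀ x > (0:ℝ), ∀ t > (0:ℝ), W x t = 0 := by
  have hxreg : ∀ t > (0:ℝ), ContDiffOn ℝ 3 (fun y => W y t) (Ici 0) := by
    intro t ht
    refine hreg.comp (f := fun y : ℝ => (y, t)) (by fun_prop) ?_
    intro y hy
    refine ⟨⟨hy, ht.le⟩, ?_⟩
    simp only [mem_singleton_iff, Prod.mk.injEq, not_and]
    exact fun _ => ht.ne'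
  have htreg : ∀ x > (0:ℝ), ContDiffOn ℝ 3 (fun s => W x s) (Ici 0) := by
    intro x hx
    refine hreg.comp (f := fun s : ℝ => (x, s)) (by fun_prop) ?_
    intro y hy
    refine ⟨⟨hx.le, hy⟩, ?_⟩
    simp only [mem_singleton_iff, Prod.mk.injEq, not_and]
    exact fun h => absurd h hx.ne'
  have hWc : ∀ t > (0:ℝ), ContinuousOn (fun y => W y t) (Ioi 0) := fun t ht =>
    (hxreg t ht).continuousOn.mono Ioi_subset_Ici_self
  have hWtc : ∀ t > (0:ℝ), ContinuousOn (fun y => deriv (fun s => W y s) t) (Ioi 0) := by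
    intro t ht
    have h1 : ContinuousOn (iteratedDerivWithin 3 (fun y => W y t) (Ici 0)) (Ioi 0) :=
      ((hxreg t ht).continuousOn_iteratedDerivWithin (by norm_num)
        (uniqueDiffOn_Ici 0)).mono Ioi_subset_Ici_self
    refine h1.neg.congr ?_
    intro x hx
    have hx' : (0:ℝ) < x := hx
    simp only [Pi.neg_apply]
    rw [hpde x hx t ht, iteratedDerivWithin_eq_iteratedDeriv (uniqueDiffOn_Ici 0)
      ((hxreg t ht).contDiffAt (Ici_mem_nhds hx')) hx'.le]
  have hmeas : ∀ t > (0:ℝ), AEStronglyMeasurable (fun x => (W x t)^2)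
      (volume.restrict (Ioi (0:ℝ))) := fun t ht =>
    ((hWc t ht).pow 2).aestronglyMeasurable measurableSet_Ioi
  have hmeas' : ∀ t > (0:ℝ), AEStronglyMeasurable
      (fun x => 2 * (W x t * deriv (fun s => W x s) t)) (volume.restrict (Ioi (0:ℝ))) :=
    fun t ht => (continuousOn_const.mul
      ((hWc t ht).mul (hWtc t ht))).aestronglyMeasurable measurableSet_Ioi
  have hint : ∀ t > (0:ℝ), IntegrableOn (fun x => (W x t)^2) (Ioi 0) := by
    intro t ht
    obtain ⟨B, -, hBi, hBb⟩ := hB t ht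
    refine Integrable.mono' hBi (hmeas t ht) ?_
    filter_upwards [ae_restrict_mem measurableSet_Ioi] with x hx
    rw [Real.norm_of_nonneg (sq_nonneg _)]
    exact (hBb x hx t ⟨ht, le_rfl⟩).1
  set E : ℝ → ℝ := fun t => ∫ x in Ioi (0:ℝ), (W x t)^2 with hE
  have hEd : ∀ t > (0:ℝ), ∃ d ≤ (0:ℝ), HasDerivAt E d t := by
    intro t ht
    obtain ⟨B, hB0, hBi, hBb⟩ := hB (t+1) (by linarith)
    have hs : Ioo 0 (t+1) ∈ 𝓝 t := Ioo_mem_nhds ht (by linarith)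
    have key := hasDerivAt_integral_of_dominated_loc_of_deriv_le
      (μ := volume.restrict (Ioi (0:ℝ)))
      (F := fun t x => (W x t)^2)
      (F' := fun t x => 2 * (W x t * deriv (fun s => W x s) t))
      (bound := fun x => 2 * B x) (x₀ := t) hs
      (by filter_upwards [hs] with s hs using hmeas s hs.1)
      (hint t ht) (hmeas' t ht)
      (by
        filter_upwards [ae_restrict_mem measurableSet_Ioi] with x hx s hs
        obtain ⟨h1, h2⟩ := hBb x hx s ⟨hs.1, hs.2.le⟩
        rw [Real.norm_eq_abs, abs_le]
        constructor
        · nlinarith [sq_nonneg (W x s + deriv (fun s => W x s) s)]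
        · nlinarith [sq_nonneg (W x s - deriv (fun s => W x s) s)])
      (hBi.const_mul 2)
      (by
        filter_upwards [ae_restrict_mem measurableSet_Ioi] with x hx s hs
        have h1 : DifferentiableAt ℝ (fun s => W x s) s :=
          ((htreg x hx).contDiffAt (Ici_mem_nhds hs.1)).differentiableAt (by norm_num)
        refine (h1.hasDerivAt.pow 2).congr_deriv ?_
        norm_num
        ring)
    refine ⟨_, ?_, key.2⟩
    have hi : IntegrableOn (fun x => W x t * iteratedDeriv 3 (fun y => W y t) x) (Ioi 0) := by
      have h3 := key.1.const_mul (-1/2)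
      refine IntegrableOn.congr_fun (f := fun x => -1/2 * (2 * (W x t * deriv (fun s => W x s) t)))
        h3 ?_ measurableSet_Ioi
      intro x hx
      simp only
      rw [hpde x hx t ht]
      ring
    have hpos := half_line_energy (fun y => W y t) (hxreg t ht) (hbdry t ht) (hlim t ht)
      (hlim' t ht) (hbd t ht) hi
    have h4 : ∫ x in Ioi (0:ℝ), 2 * (W x t * deriv (fun s => W x s) t)
        = ∫ x in Ioi (0:ℝ), (-2) * (W x t * iteratedDeriv 3 (fun y => W y t) x) := by
      refine setIntegral_congr_fun measurableSet_Ioi ?_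
      intro x hx
      simp only
      rw [hpde x hx t ht]
      ring
    rw [h4, integral_const_mul]
    linarith
  have hanti : AntitoneOn E (Ioi 0) := by
    refine antitoneOn_of_deriv_nonpos (convex_Ioi 0) ?_ ?_ ?_
    · intro t ht
      obtain ⟨d, -, hd⟩ := hEd t ht
      exact hd.continuousAt.continuousWithinAt
    · intro t ht
      rw [interior_Ioi] at ht
      obtain ⟨d, -, hd⟩ := hEd t ht
      exact hd.differentiableAt.differentiableWithinAt
    · intro t ht
      rw [interior_Ioi] at ht
      obtain ⟨d, hd0, hd⟩ := hEd t ht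
      rwa [hd.deriv]
  have hE0 : Tendsto E (𝓝[>] 0) (𝓝 0) := by
    obtain ⟨B, hB0, hBi, hBb⟩ := hB 1 one_pos
    have hm : Ioc (0:ℝ) 1 ∈ 𝓝[>] (0:ℝ) := Ioc_mem_nhdsGT one_pos
    have := tendsto_integral_filter_of_dominated_convergence
      (μ := volume.restrict (Ioi (0:ℝ))) (l := 𝓝[>] (0:ℝ))
      (F := fun t x => (W x t)^2) (f := fun _ => (0:ℝ)) B
      (by filter_upwards [hm] with s hs using hmeas s hs.1)
      (by
        filter_upwards [hm] with s hs
        filter_upwards [ae_restrict_mem measurableSet_Ioi] with x hx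
        rw [Real.norm_of_nonneg (sq_nonneg _)]
        exact (hBb x hx s hs).1)
      hBi
      (by
        filter_upwards [ae_restrict_mem measurableSet_Ioi] with x hx
        have h1 : Tendsto (fun s => W x s) (𝓝[>] 0) (𝓝 (W x 0)) :=
          ((htreg x hx).continuousOn 0 (by simp)).mono_left
            (nhdsWithin_mono _ Ioi_subset_Ici_self)
        rw [hinit x hx] at h1
        simpa using h1.pow 2)
    simpa using this
  intro x hx t ht
  have hEt : E t ≤ 0 := by
    refine ge_of_tendsto hE0 ?_
    filter_upwards [Ioc_mem_nhdsGT ht] with s hs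
    exact hanti hs.1 ht hs.2
  have hEt' : E t = 0 := le_antisymm hEt (integral_nonneg fun x => sq_nonneg _)
  have hae : (fun x => (W x t)^2) =ᵐ[volume.restrict (Ioi (0:ℝ))] fun _ => (0:ℝ) :=
    (integral_eq_zero_iff_of_nonneg (fun x => sq_nonneg _) (hint t ht)).1 hEt'
  have := Measure.eqOn_open_of_ae_eq hae isOpen_Ioi ((hWc t ht).pow 2) continuousOn_const hx
  simpa using this
end
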